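/- arXiv:2010.13079 — 3 statements merged into one kernel-verified Lean document; each statement's English description precedes it below -/
import Mathlib

section
/- Let q = p^e be a power of a prime with q ≡ 1 (mod 6), let ω be a fixed generator of the character group of 𝔽_q^×, and set t = (q-1)/6. Then for every integer j, g(ω^{6j}) = (∏_{i=0}^{5} g(ω^{it+j})) / (ω^{-6j}(6)·∏_{i=1}^{5} g(ω^{it})). -/
open scoped Classical

noncomputable section

/-- The Gauss sum `g(χ) = ∑ₓ χ(x) exp(2π√-1 · tr(x)/p)` of a multiplicative character `χ`
of a finite field `F` of characteristic `p`, where `tr : F → 𝔽_p` is the trace map. -/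
def gaussChar (p : ℕ) (F : Type) [Field F] [Fintype F] [Algebra (ZMod p) F]
    (χ : MulChar F ℂ) : ℂ :=
  ∑ x : F, χ x *
    Complex.exp (2 * Real.pi * Complex.I * ((Algebra.trace (ZMod p) F x).val : ℂ) / (p : ℂ))

/-- The Jacobi sum `J(χ₁, …, χₙ) = ∑_{x₁ + ⋯ + xₙ = 1} χ₁(x₁) ⋯ χₙ(xₙ)`. -/
def jacobiS (F : Type) [Field F] [Fintype F] {n : ℕ} (χ : Fin n → MulChar F ℂ) : ℂ :=
  ∑ v ∈ Finset.univ.filter (fun v : Fin n → F => ∑ i, v i = 1), ∏ i, χ i (v i)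

/-- The normalized Jacobi sum `binom(A; B) = (B(-1)/q) · J(A, B̄)`. -/
def gBinom (F : Type) [Field F] [Fintype F] (A B : MulChar F ℂ) : ℂ :=
  B (-1) / (Fintype.card F : ℂ) * jacobiS F ![A, B⁻¹]

/-- Greene's finite-field hypergeometric function `ₙ₊₁Fₙ` (case `n ≥ 2`), where the sum over all
multiplicative characters is written as a sum over the powers `ω^j`, `0 ≤ j ≤ q - 2`, of a fixed
generator `ω` of the character group. -/
def greeneF (F : Type) [Field F] [Fintype F] (ω : MulChar F ℂ) {n : ℕ}
    (A : Fin (n + 1) → MulChar F ℂ) (B : Fin n → MulChar F ℂ) (x : F) : ℂ :=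
  (Fintype.card F : ℂ) / ((Fintype.card F : ℂ) - 1) *
    ∑ j ∈ Finset.range (Fintype.card F - 1),
      gBinom F (A 0 * ω ^ j) (ω ^ j) *
        (∏ i : Fin n, gBinom F (A i.succ * ω ^ j) (B i * ω ^ j)) * (ω ^ j) x

/-- Greene's finite-field hypergeometric function `₂F₁` (case `n = 1`):
`₂F₁(A₀, A₁; B₁ | x) = ε(x) · (A₁B₁(-1)/q) · ∑_y A₁(y) (A̅₁B₁)(1-y) A̅₀(1-xy)`. -/
def greene2F1 (F : Type) [Field F] [Fintype F] (A₀ A₁ B₁ : MulChar F ℂ) (x : F) : ℂ :=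
  (1 : MulChar F ℂ) x * ((A₁ * B₁) (-1) / (Fintype.card F : ℂ)) *
    ∑ y : F, A₁ y * (A₁⁻¹ * B₁) (1 - y) * A₀⁻¹ (1 - x * y)

/-- The number of `F`-rational points of the Dwork hypersurface
`x₁^d + ⋯ + x_d^d = dλ x₁ ⋯ x_d` in projective space. -/
def dworkCount (F : Type) [Field F] [Fintype F] (d : ℕ) (lam : F) : ℕ :=
  Nat.card {P : Projectivization F (Fin d → F) //
    ∑ i, P.rep i ^ d = (d : F) * lam * ∏ i, P.rep i}

/-- The number of `F`-rational points of the diagonal hypersurface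
`x₁^d + ⋯ + xₙ^d = dλ x₁^{h₁} ⋯ xₙ^{hₙ}` in projective space. -/
def diagCount (F : Type) [Field F] [Fintype F] (d n : ℕ) (h : Fin n → ℕ) (lam : F) : ℕ :=
  Nat.card {P : Projectivization F (Fin n → F) //
    ∑ i, P.rep i ^ d = (d : F) * lam * ∏ i, P.rep i ^ h i}

/-- The quantity `N_q(0, w)` from Koblitz's formula, with `t = (q - 1)/d`. -/
def NqW (p : ℕ) (F : Type) [Field F] [Fintype F] [Algebra (ZMod p) F]
    (ω : MulChar F ℂ) (d : ℕ) {n : ℕ} (w : Fin n → ZMod d) : ℂ :=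
  if ∀ i, w i = 0 then ((Fintype.card F : ℂ) ^ (n - 1) - 1) / ((Fintype.card F : ℂ) - 1)
  else if ∀ i, w i ≠ 0 then
    (1 / (Fintype.card F : ℂ)) *
      ∏ i, gaussChar p F (ω ^ ((w i).val * ((Fintype.card F - 1) / d)))
  else 0

/-- The quantity `S_{[w]} = (q-1)⁻¹ ∑_{j=0}^{q-2} (∏ᵢ g(ω^{wᵢt + hᵢj}) / g(ω^{dj})) ω^{dj}(dλ)`
from Koblitz's formula, with `t = (q - 1)/d`. -/
def SW (p : ℕ) (F : Type) [Field F] [Fintype F] [Algebra (ZMod p) F]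
    (ω : MulChar F ℂ) (d : ℕ) {n : ℕ} (h : Fin n → ℕ) (w : Fin n → ZMod d) (lam : F) : ℂ :=
  ((Fintype.card F : ℂ) - 1)⁻¹ *
    ∑ j ∈ Finset.range (Fintype.card F - 1),
      (∏ i, gaussChar p F (ω ^ ((w i).val * ((Fintype.card F - 1) / d) + h i * j))) /
          gaussChar p F (ω ^ (d * j)) * (ω ^ (d * j)) ((d : F) * lam)

end

namespace HD

lemma core {ι : Type*} [Fintype ι] (G H : ι → ℂ) (hn : ∀ i, G i * star (G i) = H i * star (H i))
    (hs : ∑ i, G i * star (H i) = ∑ i, H i * star (H i)) (i : ι) : G i = H i := by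
  have hreal : star (∑ i, G i * star (H i)) = ∑ i, G i * star (H i) := by
    rw [hs, star_sum]
    exact Finset.sum_congr rfl fun i _ => by rw [star_mul, star_star]
  have hs' : ∑ i, H i * star (G i) = ∑ i, H i * star (H i) := by
    rw [← hs, ← hreal, star_sum]
    exact Finset.sum_congr rfl fun i _ => by rw [star_mul, star_star]
  have h0 : ∑ i, (G i - H i) * star (G i - H i) = 0 := by
    have : ∀ i, (G i - H i) * star (G i - H i) =
        (H i * star (H i) - G i * star (H i)) + (H i * star (H i) - H i * star (G i)) := by
      intro i
      rw [star_sub]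
      linear_combination hn i
    simp_rw [this]
    rw [Finset.sum_add_distrib, Finset.sum_sub_distrib, Finset.sum_sub_distrib, hs, hs']
    ring
  have h1 : ∑ i, Complex.normSq (G i - H i) = 0 := by
    have h2 : ((∑ i, Complex.normSq (G i - H i) : ℝ) : ℂ) = 0 := by
      rw [← h0]
      push_cast
      refine Finset.sum_congr rfl fun i _ => ?_
      rw [← Complex.mul_conj]
      rfl
    exact_mod_cast h2
  have h3 := (Finset.sum_eq_zero_iff_of_nonneg (fun i _ => Complex.normSq_nonneg _)).1 h1 i
    (Finset.mem_univ i)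
  rw [Complex.normSq_eq_zero] at h3
  exact sub_eq_zero.1 h3

variable {F : Type} [Field F] [Fintype F]
set_option linter.unusedSectionVars false

noncomputable instance fintypeMulChar : Fintype (MulChar F ℂ) := Fintype.ofFinite _

lemma card_units' : (Fintype.card (MulChar F ℂ) : ℂ) = (Fintype.card F : ℂ) - 1 := by
  have h : Nat.card (MulChar F ℂ) = Nat.card Fˣ :=
    MulChar.card_eq_card_units_of_hasEnoughRootsOfUnity F ℂ
  rw [Nat.card_eq_fintype_card, Nat.card_eq_fintype_card, Fintype.card_units] at h
  rw [h, Nat.cast_sub Fintype.card_pos, Nat.cast_one]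

lemma sumchars (a : F) :
    ∑ χ : MulChar F ℂ, χ a = if a = 1 then (Fintype.card F : ℂ) - 1 else 0 := by
  split_ifs with h
  · subst h
    simp [card_units']
  · obtain ⟨χ, hχ⟩ := MulChar.exists_apply_ne_one_of_hasEnoughRootsOfUnity F ℂ h
    have h1 : ∑ η : MulChar F ℂ, (χ * η) a = ∑ η : MulChar F ℂ, η a :=
      Fintype.sum_equiv (Equiv.mulLeft χ) _ _ fun _ => rfl
    simp_rw [MulChar.mul_apply] at h1
    rw [← Finset.mul_sum] at h1
    have h2 : (χ a - 1) * ∑ η : MulChar F ℂ, η a = 0 := by linear_combination h1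
    exact (mul_eq_zero.1 h2).resolve_left (sub_ne_zero.2 hχ)

lemma normsq {χ : MulChar F ℂ} (hχ : χ ≠ 1) {ψ : AddChar F ℂ} (hψ : ψ.IsPrimitive) :
    gaussSum χ ψ * star (gaussSum χ ψ) = Fintype.card F := by
  rw [star_gaussSum_eq, gaussSum_mul_gaussSum_eq_card hχ hψ]

lemma prim_ne_one {ψ : AddChar F ℂ} (hψ : ψ.IsPrimitive) : ψ ≠ 1 := by
  have := hψ one_ne_zero
  rwa [AddChar.mulShift_one] at this

lemma prim_shift {ψ : AddChar F ℂ} (hψ : ψ.IsPrimitive) {c : F} (hc : c ≠ 0) :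
    (ψ.mulShift c).IsPrimitive := AddChar.IsPrimitive.of_ne_one (hψ hc)

lemma sum_units (f : F → ℂ) : ∑ w : Fˣ, f w = ∑ w : F, f w - f 0 := by
  rw [← Finset.sum_erase_eq_sub (Finset.mem_univ 0)]
  refine Finset.sum_bij' (fun w _ => (w : F)) (fun w hw => Units.mk0 w (Finset.ne_of_mem_erase hw))
    ?_ ?_ ?_ ?_ ?_ <;> simp

lemma sum_units_psi {ψ : AddChar F ℂ} (hψ : ψ.IsPrimitive) (s : F) :
    ∑ w : Fˣ, ψ (w * s) = (if s = 0 then (Fintype.card F : ℂ) else 0) - 1 := by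
  rw [sum_units (fun w => ψ (w * s)), AddChar.sum_mulShift s hψ]
  simp

/-- the star of the Gauss sum of the twisted power character, as a sum over units -/
lemma star_L (χ : MulChar F ℂ) (ψ : AddChar F ℂ) (c : F) :
    star (gaussSum χ (ψ.mulShift c)) = ∑ w : Fˣ, χ⁻¹ w * ψ (w * (-c)) := by
  rw [star_gaussSum_eq, sum_units (fun w => χ⁻¹ w * ψ (w * (-c)))]
  simp [gaussSum, AddChar.inv_apply, AddChar.mulShift_apply, mul_comm c, MulChar.map_zero]

lemma T3 (ρ : MulChar F ℂ) (θ : AddChar F ℂ) :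
    ∑ χ : MulChar F ℂ, gaussSum χ θ * gaussSum (χ * ρ) θ * gaussSum (χ * ρ⁻¹) θ =
      ((Fintype.card F : ℂ) - 1) * ∑ y : F, ∑ z : F, ρ y * ρ⁻¹ z * θ (y⁻¹ * z⁻¹ + y + z) := by
  have h1 : ∀ χ : MulChar F ℂ,
      gaussSum χ θ * gaussSum (χ * ρ) θ * gaussSum (χ * ρ⁻¹) θ =
      ∑ y : F, ∑ z : F, ∑ x : F, χ (x * y * z) * (ρ y * ρ⁻¹ z * θ (x + y + z)) := by
    intro χ
    unfold gaussSum
    rw [mul_assoc, Finset.sum_mul_sum, mul_comm, Finset.sum_mul]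
    refine Finset.sum_congr rfl fun y _ => ?_
    rw [Finset.sum_mul]
    refine Finset.sum_congr rfl fun z _ => ?_
    rw [Finset.mul_sum]
    refine Finset.sum_congr rfl fun x _ => ?_
    simp only [map_mul, MulChar.mul_apply, AddChar.map_add_eq_mul]
    ring
  simp_rw [h1]
  rw [Finset.sum_comm, Finset.mul_sum]
  refine Finset.sum_congr rfl fun y _ => ?_
  rw [Finset.sum_comm, Finset.mul_sum]
  refine Finset.sum_congr rfl fun z _ => ?_
  rw [Finset.sum_comm]
  simp_rw [← Finset.sum_mul, sumchars]
  by_cases hy : y = 0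
  · simp [hy, MulChar.map_zero]
  by_cases hz : z = 0
  · simp [hz, MulChar.map_zero]
  have : ∀ x, x * y * z = 1 ↔ x = y⁻¹ * z⁻¹ := by
    intro x
    constructor
    · intro h
      field_simp
      linear_combination h
    · rintro rfl
      field_simp
  simp_rw [this, ite_mul, zero_mul]
  simp

lemma T2 (ρ : MulChar F ℂ) (θ : AddChar F ℂ) :
    ∑ χ : MulChar F ℂ, gaussSum χ θ * gaussSum (χ * ρ) θ =
      ((Fintype.card F : ℂ) - 1) * ∑ y : F, ρ y * θ (y⁻¹ + y) := by
  have h1 : ∀ χ : MulChar F ℂ,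
      gaussSum χ θ * gaussSum (χ * ρ) θ =
      ∑ y : F, ∑ x : F, χ (x * y) * (ρ y * θ (x + y)) := by
    intro χ
    unfold gaussSum
    rw [mul_comm, Finset.sum_mul]
    refine Finset.sum_congr rfl fun y _ => ?_
    rw [Finset.mul_sum]
    refine Finset.sum_congr rfl fun x _ => ?_
    simp only [map_mul, MulChar.mul_apply, AddChar.map_add_eq_mul]
    ring
  simp_rw [h1]
  rw [Finset.sum_comm, Finset.mul_sum]
  refine Finset.sum_congr rfl fun y _ => ?_
  rw [Finset.sum_comm]
  simp_rw [← Finset.sum_mul, sumchars]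
  by_cases hy : y = 0
  · simp [hy, MulChar.map_zero]
  have : ∀ x, x * y = 1 ↔ x = y⁻¹ := by
    intro x
    exact mul_eq_one_iff_eq_inv₀ hy
  simp_rw [this, ite_mul, zero_mul]
  simp

/-- The sum over the nodal cubic `xyz = 1`, `x + y + z = 3`. -/
lemma nodal (ρ : MulChar F ℂ) (hρ : ρ ^ 3 = 1) (h3 : (3 : F) ≠ 0) (ζ : F) (hζ : ζ ^ 2 + ζ + 1 = 0) :
    ∑ y : F, ∑ z : F, (if y⁻¹ * z⁻¹ + y + z = 3 then ρ y * ρ⁻¹ z else 0) =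
      (Fintype.card F : ℂ) - 3 := by
  have hcube : ∀ b : F, b ≠ 0 → ρ (b ^ 3) = 1 := by
    intro b hb
    rw [map_pow, ← MulChar.pow_apply' _ (by norm_num), hρ, MulChar.one_apply hb.isUnit]
  have hρ0 : ρ 0 = 0 := MulChar.map_zero ρ
  have hζ1 : ζ ≠ 1 := by
    rintro rfl
    apply h3
    linear_combination hζ
  rw [← Finset.sum_product', ← Finset.sum_filter]
  set S : Finset (F × F) := Finset.univ.filter
    (fun v : F × F => v.1 ≠ 0 ∧ v.2 ≠ 0 ∧ v.1⁻¹ * v.2⁻¹ + v.1 + v.2 = 3 ∧ v ≠ (1, 1)) with hS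
  have hroot : ∀ b : F, b ^ 2 + b + 1 = 0 ↔ b = ζ ∨ b = -1 - ζ := by
    intro b
    rw [← sub_eq_zero (b := ζ), ← sub_eq_zero (b := -1 - ζ), ← mul_eq_zero]
    have : (b - ζ) * (b - (-1 - ζ)) = b ^ 2 + b + 1 := by linear_combination -hζ
    rw [this]
  have hmain : ∀ y z : F, y ≠ 0 → z ≠ 0 → y⁻¹ * z⁻¹ + y + z = 3 → y * z * (y + z) + 1 = 3 * (y * z) := by
    intro y z hy hz h
    field_simp at h
    linear_combination h
  have hz1 : ∀ y z : F, y ≠ 0 → z ≠ 0 → y⁻¹ * z⁻¹ + y + z = 3 → (y, z) ≠ (1, 1) → z - 1 ≠ 0 := by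
    intro y z hy hz h hne hz1
    have hz1' : z = 1 := sub_eq_zero.1 hz1
    subst hz1'
    have h' := hmain y 1 hy hz h
    have : (y - 1) ^ 2 = 0 := by linear_combination h'
    have : y = 1 := sub_eq_zero.1 (pow_eq_zero_iff (two_ne_zero)|>.1 this)
    exact hne (by rw [this])
  have hyz' : ∀ y z : F, y ≠ 0 → z ≠ 0 → y⁻¹ * z⁻¹ + y + z = 3 → (y, z) ≠ (1, 1) →
      y * z⁻¹ = ((y - 1) / (z - 1)) ^ 3 := by
    intro y z hy hz h hne
    have hz' := hz1 y z hy hz h hne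
    have h' := hmain y z hy hz h
    field_simp
    linear_combination (z - y) * h'
  have hy1 : ∀ y z : F, y ≠ 0 → z ≠ 0 → y⁻¹ * z⁻¹ + y + z = 3 → (y, z) ≠ (1, 1) → y - 1 ≠ 0 := by
    intro y z hy hz h hne
    refine hz1 z y hz hy ?_ ?_
    · linear_combination h
    · intro h0
      apply hne
      rw [Prod.mk.injEq] at h0 ⊢
      exact ⟨h0.2, h0.1⟩
  have hs2 : ∀ y z : F, y ≠ 0 → z ≠ 0 → y⁻¹ * z⁻¹ + y + z = 3 → (y, z) ≠ (1, 1) →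
      y + z - 2 ≠ 0 := by
    intro y z hy hz h hne h0
    have h' := hmain y z hy hz h
    have : (y - 1) ^ 2 = 0 := by linear_combination h' + (y - y * z) * h0
    exact hy1 y z hy hz h hne ((pow_eq_zero_iff two_ne_zero).1 this)
  have hval : ∀ v ∈ S, ρ v.1 * ρ⁻¹ v.2 = 1 := by
    rintro ⟨y, z⟩ hv
    simp only [hS, Finset.mem_filter, Finset.mem_univ, true_and] at hv
    obtain ⟨hy, hz, h, hne⟩ := hv
    have hz' := hz1 y z hy hz h hne
    have h' := hmain y z hy hz h
    have hyz := hyz' y z hy hz h hne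
    rw [MulChar.inv_apply', ← map_mul]
    simp only
    rw [hyz]
    apply hcube
    intro h0
    rw [h0] at hyz
    have : y * z⁻¹ ≠ 0 := mul_ne_zero hy (inv_ne_zero hz)
    exact this (by rw [hyz]; ring)
  have hcard : S.card = (Finset.univ \ ({0, -1, ζ, -1 - ζ} : Finset F)).card := by
    refine Finset.card_bij' (fun v _ => (v.1 - 1) / (v.2 - 1))
      (fun b _ => (-b ^ 2 / (1 + b), -1 / (b * (1 + b)))) ?_ ?_ ?_ ?_
    · rintro ⟨y, z⟩ hv
      simp only [hS, Finset.mem_filter, Finset.mem_univ, true_and] at hv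
      obtain ⟨hy, hz, h, hne⟩ := hv
      have hz' := hz1 y z hy hz h hne
      have hy' := hy1 y z hy hz h hne
      have hs' := hs2 y z hy hz h hne
      have hq := hyz' y z hy hz h hne
      simp only [Finset.mem_sdiff, Finset.mem_univ, true_and, Finset.mem_insert,
        Finset.mem_singleton]
      rw [← hroot]
      rintro (h0 | h0 | h0)
      · exact div_ne_zero hy' hz' h0
      · rw [div_eq_iff hz'] at h0
        apply hs'
        linear_combination h0
      · set b := (y - 1) / (z - 1) with hb
        have hb3 : b ^ 3 = 1 := by linear_combination (b - 1) * h0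
        rw [hb3, ← div_eq_mul_inv, div_eq_iff hz, one_mul] at hq
        subst hq
        rw [div_self hz'] at hb
        rw [hb] at h0
        apply h3
        linear_combination h0
    · intro b hb
      simp only [Finset.mem_sdiff, Finset.mem_univ, true_and, Finset.mem_insert,
        Finset.mem_singleton] at hb
      rw [← hroot] at hb
      push Not at hb
      obtain ⟨hb0, hb1, hb2⟩ := hb
      have hb1' : 1 + b ≠ 0 := fun h => hb1 (by linear_combination h)
      simp only [hS, Finset.mem_filter, Finset.mem_univ, true_and]
      refine ⟨?_, ?_, ?_, ?_⟩
      · exact div_ne_zero (neg_ne_zero.2 (pow_ne_zero 2 hb0)) hb1'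
      · exact div_ne_zero (neg_ne_zero.2 one_ne_zero) (mul_ne_zero hb0 hb1')
      · field_simp
        ring
      · intro h
        rw [Prod.mk.injEq, div_eq_iff hb1'] at h
        apply hb2
        linear_combination -h.1
    · rintro ⟨y, z⟩ hv
      simp only [hS, Finset.mem_filter, Finset.mem_univ, true_and] at hv
      obtain ⟨hy, hz, h, hne⟩ := hv
      have hz' := hz1 y z hy hz h hne
      have hy' := hy1 y z hy hz h hne
      have hs' := hs2 y z hy hz h hne
      have h' := hmain y z hy hz h
      have e : 1 + (y - 1) / (z - 1) = (y + z - 2) / (z - 1) := by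
        field_simp
        ring
      simp only [Prod.mk.injEq]
      rw [e]
      constructor
      · field_simp
        linear_combination -h'
      · field_simp
        linear_combination -h'
    · intro b hb
      simp only [Finset.mem_sdiff, Finset.mem_univ, true_and, Finset.mem_insert,
        Finset.mem_singleton] at hb
      rw [← hroot] at hb
      push Not at hb
      obtain ⟨hb0, hb1, hb2⟩ := hb
      have hb1' : 1 + b ≠ 0 := fun h => hb1 (by linear_combination h)
      have e1 : -b ^ 2 / (1 + b) - 1 = -(b ^ 2 + b + 1) / (1 + b) := by
        field_simp
        ring
      have e2 : -1 / (b * (1 + b)) - 1 = -(b ^ 2 + b + 1) / (b * (1 + b)) := by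
        field_simp
        ring
      simp only
      rw [e1, e2]
      have hb2' : b * (b + 1) + 1 ≠ 0 := fun h => hb2 (by linear_combination h)
      field_simp
  have hζ0 : ζ ≠ 0 := by
    rintro rfl
    simp at hζ
  have hζm : ζ ≠ -1 := by
    rintro rfl
    norm_num at hζ
  have hcard2 : ({0, -1, ζ, -1 - ζ} : Finset F).card = 4 := by
    rw [Finset.card_insert_of_notMem, Finset.card_insert_of_notMem, Finset.card_pair]
    · intro h
      apply h3
      linear_combination 4 * hζ - (2 * ζ + 1) * h
    · simp only [Finset.mem_insert, Finset.mem_singleton, not_or]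
      exact ⟨hζm.symm, fun h => hζ0 (by linear_combination h)⟩
    · simp only [Finset.mem_insert, Finset.mem_singleton, not_or]
      exact ⟨fun h => one_ne_zero (α := F) (by linear_combination h), hζ0.symm,
        fun h => hζm (by linear_combination h)⟩
  have hsub := Finset.card_sdiff_add_card_eq_card
    (Finset.subset_univ ({0, -1, ζ, -1 - ζ} : Finset F))
  rw [← hcard, hcard2, Finset.card_univ] at hsub
  have hins : (1, 1) ∉ S := by simp [hS]
  rw [← Finset.sum_subset (s₁ := insert (1, 1) S), Finset.sum_insert hins,
    Finset.sum_congr rfl hval, ← hsub]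
  · simp
    ring
  · intro v hv
    rw [Finset.mem_insert] at hv
    simp only [Finset.mem_filter, Finset.mem_product, Finset.mem_univ, true_and]
    rcases hv with rfl | hv
    · norm_num
    · simp only [hS, Finset.mem_filter, Finset.mem_univ, true_and] at hv
      exact hv.2.2.1
  · rintro ⟨y, z⟩ hv hv'
    simp only [Finset.mem_filter, Finset.mem_product, Finset.mem_univ, true_and] at hv
    simp only [hS, Finset.mem_insert, Finset.mem_filter, Finset.mem_univ, true_and, not_or] at hv'
    by_cases hy : y = 0
    · simp [hy, hρ0]
    by_cases hz : z = 0
    · simp [hz, MulChar.map_zero]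
    exact absurd ⟨hy, hz, hv, hv'.1⟩ hv'.2

/-- Hasse-Davenport for `m = 3`. -/
lemma hd3 {ψ : AddChar F ℂ} (hψ : ψ.IsPrimitive) (ρ : MulChar F ℂ) (hρ : ρ ^ 3 = 1) (hρ1 : ρ ≠ 1)
    (hall : ∀ χ : MulChar F ℂ, χ ^ 3 = 1 → χ = 1 ∨ χ = ρ ∨ χ = ρ⁻¹)
    (h3 : (3 : F) ≠ 0) (ζ : F) (hζ : ζ ^ 2 + ζ + 1 = 0) (χ : MulChar F ℂ) :
    gaussSum χ ψ * gaussSum (χ * ρ) ψ * gaussSum (χ * ρ⁻¹) ψ =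
      (Fintype.card F : ℂ) * gaussSum (χ ^ 3) (ψ.mulShift 3) := by
  have hρinv : ρ⁻¹ ≠ 1 := inv_ne_one.2 hρ1
  have hρi3 : ρ⁻¹ ^ 3 = 1 := by rw [inv_pow, hρ, inv_one]
  have hρne : ρ ≠ ρ⁻¹ := by
    intro h
    apply hρ1
    have h2 : ρ * ρ = 1 := by
      nth_rewrite 2 [h]
      exact mul_inv_cancel ρ
    rw [pow_succ, pow_two, h2, one_mul] at hρ
    exact hρ
  have hρρ : ρ * ρ = ρ⁻¹ := by
    rw [eq_inv_iff_mul_eq_one, ← hρ, pow_succ, pow_two]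
  have hρρ' : ρ⁻¹ * ρ⁻¹ = ρ := by
    rw [← mul_inv, hρρ, inv_inv]
  have h1s : gaussSum (1 : MulChar F ℂ) ψ = -1 := gaussSum_one_left (prim_ne_one hψ)
  have hψ3 := prim_shift hψ h3
  have hLn : ∀ χ : MulChar F ℂ, gaussSum (χ ^ 3) (ψ.mulShift 3) *
      star (gaussSum (χ ^ 3) (ψ.mulShift 3)) = (Fintype.card F : ℂ) -
        if χ ^ 3 = 1 then (Fintype.card F : ℂ) - 1 else 0 := by
    intro χ
    split_ifs with h
    · rw [h, gaussSum_one_left (prim_ne_one hψ3)]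
      simp
    · rw [normsq h hψ3, sub_zero]
  have hLsum : ∑ χ : MulChar F ℂ, gaussSum (χ ^ 3) (ψ.mulShift 3) *
      star (gaussSum (χ ^ 3) (ψ.mulShift 3)) =
      ((Fintype.card F : ℂ) - 1) * ((Fintype.card F : ℂ) - 3) := by
    simp_rw [hLn]
    have hf : (Finset.univ.filter fun χ : MulChar F ℂ => χ ^ 3 = 1) = {1, ρ, ρ⁻¹} := by
      ext χ
      simp only [Finset.mem_filter, Finset.mem_univ, true_and, Finset.mem_insert,
        Finset.mem_singleton]
      constructor
      · exact hall χ
      · rintro (rfl | rfl | rfl)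
        · exact one_pow 3
        · exact hρ
        · exact hρi3
    have hc : ({1, ρ, ρ⁻¹} : Finset (MulChar F ℂ)).card = 3 := by
      rw [Finset.card_insert_of_notMem, Finset.card_pair hρne]
      simp only [Finset.mem_insert, Finset.mem_singleton, not_or]
      exact ⟨hρ1.symm, hρinv.symm⟩
    rw [Finset.sum_sub_distrib, ← Finset.sum_filter, hf, Finset.sum_const, Finset.sum_const, hc,
      Finset.card_univ, nsmul_eq_mul, nsmul_eq_mul, card_units']
    push_cast
    ring
  refine core (fun χ : MulChar F ℂ => gaussSum χ ψ * gaussSum (χ * ρ) ψ * gaussSum (χ * ρ⁻¹) ψ)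
    (fun χ => (Fintype.card F : ℂ) * gaussSum (χ ^ 3) (ψ.mulShift 3)) ?_ ?_ χ
  · intro χ
    have hr : (Fintype.card F : ℂ) * gaussSum (χ ^ 3) (ψ.mulShift 3) *
        star ((Fintype.card F : ℂ) * gaussSum (χ ^ 3) (ψ.mulShift 3)) =
        (Fintype.card F : ℂ) ^ 2 * ((Fintype.card F : ℂ) -
        if χ ^ 3 = 1 then (Fintype.card F : ℂ) - 1 else 0) := by
      rw [← hLn χ, star_mul, star_natCast]
      ring
    rw [hr, star_mul, star_mul]
    have e := normsq hρ1 hψ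
    have e' := normsq hρinv hψ
    have key : ∀ a b c A B C n₁ n₂ n₃ : ℂ, a * A = n₁ → b * B = n₂ → c * C = n₃ →
        a * b * c * (C * (B * A)) = n₁ * n₂ * n₃ := by
      intro a b c A B C n₁ n₂ n₃ h1 h2 h3
      rw [← h1, ← h2, ← h3]
      ring
    have e1 : gaussSum (1 : MulChar F ℂ) ψ * star (gaussSum (1 : MulChar F ℂ) ψ) = 1 := by
      rw [h1s]
      simp
    split_ifs with h
    · rcases hall χ h with rfl | rfl | rfl
      · rw [one_mul, one_mul, key _ _ _ _ _ _ _ _ _ e1 e e']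
        ring
      · rw [mul_inv_cancel, hρρ, key _ _ _ _ _ _ _ _ _ e e' e1]
        ring
      · rw [inv_mul_cancel, hρρ', key _ _ _ _ _ _ _ _ _ e' e1 e]
        ring
    · have n1 : χ ≠ 1 := by
        rintro rfl
        exact h (one_pow 3)
      have n2 : χ * ρ ≠ 1 := by
        intro h0
        apply h
        rw [eq_inv_of_mul_eq_one_left h0, hρi3]
      have n3 : χ * ρ⁻¹ ≠ 1 := by
        intro h0
        apply h
        rw [eq_of_mul_inv_eq_one h0, hρ]
      rw [key _ _ _ _ _ _ _ _ _ (normsq n1 hψ) (normsq n2 hψ) (normsq n3 hψ)]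
      ring
  · have hrhs : ∑ χ : MulChar F ℂ, (Fintype.card F : ℂ) * gaussSum (χ ^ 3) (ψ.mulShift 3) *
        star ((Fintype.card F : ℂ) * gaussSum (χ ^ 3) (ψ.mulShift 3)) =
        (Fintype.card F : ℂ) ^ 2 *
          (((Fintype.card F : ℂ) - 1) * ((Fintype.card F : ℂ) - 3)) := by
      rw [← hLsum, Finset.mul_sum]
      refine Finset.sum_congr rfl fun χ _ => ?_
      rw [star_mul, star_natCast]
      ring
    rw [hrhs]
    have hterm : ∀ χ : MulChar F ℂ, gaussSum χ ψ * gaussSum (χ * ρ) ψ * gaussSum (χ * ρ⁻¹) ψ *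
        star ((Fintype.card F : ℂ) * gaussSum (χ ^ 3) (ψ.mulShift 3)) =
        (Fintype.card F : ℂ) * ∑ w : Fˣ, (gaussSum χ (ψ.mulShift w) *
          gaussSum (χ * ρ) (ψ.mulShift w) * gaussSum (χ * ρ⁻¹) (ψ.mulShift w)) *
            ψ (w * (-3)) := by
      intro χ
      rw [star_mul, star_natCast, star_L, mul_comm _ (Fintype.card F : ℂ), mul_left_comm,
        Finset.mul_sum]
      congr 1
      refine Finset.sum_congr rfl fun w _ => ?_
      rw [gaussSum_mulShift_eq, gaussSum_mulShift_eq, gaussSum_mulShift_eq]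
      have : (χ ^ 3)⁻¹ w = χ⁻¹ w * (χ * ρ)⁻¹ w * (χ * ρ⁻¹)⁻¹ w := by
        rw [← MulChar.mul_apply, ← MulChar.mul_apply]
        congr 1
        rw [pow_succ, pow_two]
        simp only [mul_inv, inv_inv]
        rw [show χ⁻¹ * (χ⁻¹ * ρ⁻¹) * (χ⁻¹ * ρ) = χ⁻¹ * χ⁻¹ * χ⁻¹ * (ρ⁻¹ * ρ) by
          simp only [mul_assoc, mul_comm, mul_left_comm], inv_mul_cancel, mul_one]
      rw [this]
      ring
    simp_rw [hterm]
    rw [← Finset.mul_sum, Finset.sum_comm]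
    simp_rw [← Finset.sum_mul, T3]
    have hw : ∀ w : Fˣ, ((Fintype.card F : ℂ) - 1) * (∑ y : F, ∑ z : F, ρ y * ρ⁻¹ z *
        (ψ.mulShift w) (y⁻¹ * z⁻¹ + y + z)) * ψ (w * (-3)) =
        ((Fintype.card F : ℂ) - 1) * (∑ y : F, ∑ z : F, ρ y * ρ⁻¹ z *
          ψ (w * (y⁻¹ * z⁻¹ + y + z - 3))) := by
      intro w
      rw [mul_assoc, Finset.sum_mul]
      congr 1
      refine Finset.sum_congr rfl fun y _ => ?_
      rw [Finset.sum_mul]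
      refine Finset.sum_congr rfl fun z _ => ?_
      rw [mul_assoc, AddChar.mulShift_apply, ← AddChar.map_add_eq_mul]
      congr 2
      ring
    simp_rw [hw]
    rw [← Finset.mul_sum, Finset.sum_comm]
    have hy : ∀ y : F, ∑ w : Fˣ, ∑ z : F, ρ y * ρ⁻¹ z * ψ (w * (y⁻¹ * z⁻¹ + y + z - 3)) =
        (Fintype.card F : ℂ) * (∑ z : F, if y⁻¹ * z⁻¹ + y + z = 3 then ρ y * ρ⁻¹ z else 0) := by
      intro y
      rw [Finset.sum_comm]
      simp_rw [← Finset.mul_sum, sum_units_psi hψ, sub_eq_zero, mul_sub, mul_one]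
      rw [Finset.sum_sub_distrib, ← Finset.mul_sum, MulChar.sum_eq_zero_of_ne_one hρinv, mul_zero,
        sub_zero, Finset.mul_sum]
      refine Finset.sum_congr rfl fun z _ => ?_
      split_ifs <;> ring
    simp_rw [hy]
    rw [← Finset.mul_sum, nodal ρ hρ h3 ζ hζ]
    ring

/-- Hasse-Davenport for `m = 2`. -/
lemma hd2 {ψ : AddChar F ℂ} (hψ : ψ.IsPrimitive) (φ : MulChar F ℂ) (hφ : φ ^ 2 = 1) (hφ1 : φ ≠ 1)
    (hall : ∀ χ : MulChar F ℂ, χ ^ 2 = 1 → χ = 1 ∨ χ = φ)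
    (h2 : (2 : F) ≠ 0) (χ : MulChar F ℂ) :
    gaussSum χ ψ * gaussSum (χ * φ) ψ =
      gaussSum φ ψ * gaussSum (χ ^ 2) (ψ.mulShift 2) := by
  have hφφ : φ * φ = 1 := by rw [← pow_two, hφ]
  have hφi : φ⁻¹ = φ := inv_eq_of_mul_eq_one_left hφφ
  have h1s : gaussSum (1 : MulChar F ℂ) ψ = -1 := gaussSum_one_left (prim_ne_one hψ)
  have hψ2 := prim_shift hψ h2
  have hLn : ∀ χ : MulChar F ℂ, gaussSum (χ ^ 2) (ψ.mulShift 2) *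
      star (gaussSum (χ ^ 2) (ψ.mulShift 2)) = (Fintype.card F : ℂ) -
        if χ ^ 2 = 1 then (Fintype.card F : ℂ) - 1 else 0 := by
    intro χ
    split_ifs with h
    · rw [h, gaussSum_one_left (prim_ne_one hψ2)]
      simp
    · rw [normsq h hψ2, sub_zero]
  have hLsum : ∑ χ : MulChar F ℂ, gaussSum (χ ^ 2) (ψ.mulShift 2) *
      star (gaussSum (χ ^ 2) (ψ.mulShift 2)) =
      ((Fintype.card F : ℂ) - 1) * ((Fintype.card F : ℂ) - 2) := by
    simp_rw [hLn]
    have hf : (Finset.univ.filter fun χ : MulChar F ℂ => χ ^ 2 = 1) = {1, φ} := by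
      ext χ
      simp only [Finset.mem_filter, Finset.mem_univ, true_and, Finset.mem_insert,
        Finset.mem_singleton]
      constructor
      · exact hall χ
      · rintro (rfl | rfl)
        · exact one_pow 2
        · exact hφ
    rw [Finset.sum_sub_distrib, ← Finset.sum_filter, hf, Finset.sum_const, Finset.sum_const,
      Finset.card_pair hφ1.symm,
      Finset.card_univ, nsmul_eq_mul, nsmul_eq_mul, card_units']
    push_cast
    ring
  have e := normsq hφ1 hψ
  refine core (fun χ : MulChar F ℂ => gaussSum χ ψ * gaussSum (χ * φ) ψ)
    (fun χ => gaussSum φ ψ * gaussSum (χ ^ 2) (ψ.mulShift 2)) ?_ ?_ χ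
  · intro χ
    have key : ∀ a b A B n₁ n₂ : ℂ, a * A = n₁ → b * B = n₂ →
        a * b * (B * A) = n₁ * n₂ := by
      intro a b A B n₁ n₂ h1 h2
      rw [← h1, ← h2]
      ring
    have e1 : gaussSum (1 : MulChar F ℂ) ψ * star (gaussSum (1 : MulChar F ℂ) ψ) = 1 := by
      rw [h1s]
      simp
    rw [star_mul, star_mul, key _ _ _ _ _ _ e (hLn χ)]
    split_ifs with h
    · rcases hall χ h with rfl | rfl
      · rw [one_mul, key _ _ _ _ _ _ e1 e]
        ring
      · rw [hφφ, key _ _ _ _ _ _ e e1]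
        ring
    · have n1 : χ ≠ 1 := by
        rintro rfl
        exact h (one_pow 2)
      have n2 : χ * φ ≠ 1 := by
        intro h0
        apply h
        rw [eq_inv_of_mul_eq_one_left h0, hφi, hφ]
      rw [key _ _ _ _ _ _ (normsq n1 hψ) (normsq n2 hψ)]
      ring
  · have hrhs : ∑ χ : MulChar F ℂ, gaussSum φ ψ * gaussSum (χ ^ 2) (ψ.mulShift 2) *
        star (gaussSum φ ψ * gaussSum (χ ^ 2) (ψ.mulShift 2)) =
        (Fintype.card F : ℂ) *
          (((Fintype.card F : ℂ) - 1) * ((Fintype.card F : ℂ) - 2)) := by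
      rw [← hLsum, Finset.mul_sum]
      refine Finset.sum_congr rfl fun χ _ => ?_
      rw [star_mul, ← e]
      ring
    rw [hrhs]
    have hterm : ∀ χ : MulChar F ℂ, gaussSum χ ψ * gaussSum (χ * φ) ψ *
        star (gaussSum φ ψ * gaussSum (χ ^ 2) (ψ.mulShift 2)) =
        star (gaussSum φ ψ) * ∑ w : Fˣ, (gaussSum χ (ψ.mulShift w) *
          gaussSum (χ * φ) (ψ.mulShift w)) * (φ w * ψ (w * (-2))) := by
      intro χ
      rw [star_mul, star_L, mul_comm _ (star (gaussSum φ ψ)), mul_left_comm,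
        Finset.mul_sum]
      congr 1
      refine Finset.sum_congr rfl fun w _ => ?_
      rw [gaussSum_mulShift_eq, gaussSum_mulShift_eq]
      have : (χ ^ 2)⁻¹ w = χ⁻¹ w * (χ * φ)⁻¹ w * φ w := by
        rw [← MulChar.mul_apply, ← MulChar.mul_apply]
        congr 1
        rw [pow_two]
        simp only [mul_inv]
        rw [mul_assoc, mul_assoc, inv_mul_cancel, mul_one]
      rw [this]
      ring
    simp_rw [hterm]
    rw [← Finset.mul_sum, Finset.sum_comm]
    simp_rw [← Finset.sum_mul, T2]
    have hw : ∀ w : Fˣ, ((Fintype.card F : ℂ) - 1) * (∑ y : F, φ y *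
        (ψ.mulShift w) (y⁻¹ + y)) * (φ w * ψ (w * (-2))) =
        ((Fintype.card F : ℂ) - 1) * (∑ y : F, φ y * (φ w * ψ (w * (y⁻¹ + y - 2)))) := by
      intro w
      rw [mul_assoc, Finset.sum_mul]
      congr 1
      refine Finset.sum_congr rfl fun y _ => ?_
      rw [AddChar.mulShift_apply,
        show (w : F) * (y⁻¹ + y - 2) = w * (y⁻¹ + y) + w * (-2) by ring, AddChar.map_add_eq_mul]
      ring
    simp_rw [hw]
    rw [← Finset.mul_sum, Finset.sum_comm]
    have hs : ∀ s : F, ∑ w : Fˣ, φ w * ψ (w * s) = φ s * gaussSum φ ψ := by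
      intro s
      rw [sum_units (fun w => φ w * ψ (w * s)), MulChar.map_zero, zero_mul, sub_zero]
      by_cases h0 : s = 0
      · subst h0
        simp [MulChar.map_zero, MulChar.sum_eq_zero_of_ne_one hφ1]
      · have := gaussSum_mulShift_eq φ ψ (Units.mk0 s h0)
        rw [hφi, Units.val_mk0] at this
        rw [← this]
        simp [gaussSum, AddChar.mulShift_apply, mul_comm s]
    have hy : ∀ y : F, ∑ w : Fˣ, φ y * (φ w * ψ (w * (y⁻¹ + y - 2))) =
        (if y ∈ Finset.univ \ ({0, 1} : Finset F) then 1 else 0) * gaussSum φ ψ := by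
      intro y
      rw [← Finset.mul_sum, hs, ← mul_assoc]
      congr 1
      by_cases h0 : y = 0
      · simp [h0, MulChar.map_zero]
      by_cases h1 : y = 1
      · subst h1
        norm_num [MulChar.map_zero]
      have h1' : y - 1 ≠ 0 := sub_ne_zero.2 h1
      rw [← map_mul, show y * (y⁻¹ + y - 2) = (y - 1) ^ 2 by field_simp; ring, map_pow,
        ← MulChar.pow_apply' _ two_ne_zero, hφ, MulChar.one_apply h1'.isUnit]
      simp [h0, h1]
    simp_rw [hy]
    rw [← Finset.sum_mul, Finset.sum_ite_mem, Finset.univ_inter, Finset.sum_const, nsmul_one]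
    have hc := Finset.card_sdiff_add_card_eq_card
      (Finset.subset_univ ({0, 1} : Finset F))
    rw [Finset.card_pair zero_ne_one, Finset.card_univ] at hc
    have hc' : ((Finset.univ \ ({0, 1} : Finset F)).card : ℂ) = (Fintype.card F : ℂ) - 2 := by
      rw [← hc]
      push_cast
      ring
    rw [hc', ← e]
    ring

lemma hd6 {ψ : AddChar F ℂ} (hψ : ψ.IsPrimitive) (η : MulChar F ℂ)
    (h6 : η ^ 6 = 1) (h31 : η ^ 3 ≠ 1) (h21 : η ^ 2 ≠ 1)
    (hall3 : ∀ χ : MulChar F ℂ, χ ^ 3 = 1 → χ = 1 ∨ χ = η ^ 2 ∨ χ = (η ^ 2)⁻¹)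
    (hall2 : ∀ χ : MulChar F ℂ, χ ^ 2 = 1 → χ = 1 ∨ χ = η ^ 3)
    (h2 : (2 : F) ≠ 0) (h3 : (3 : F) ≠ 0) (ζ : F) (hζ : ζ ^ 2 + ζ + 1 = 0) (χ : MulChar F ℂ) :
    ∏ i ∈ Finset.range 6, gaussSum (η ^ i * χ) ψ =
      gaussSum (η ^ 3) ψ ^ 3 * Fintype.card F * gaussSum (χ ^ 6) (ψ.mulShift 6) := by
  have hφ : (η ^ 3) ^ 2 = 1 := by rw [← pow_mul, h6]
  have hρ : (η ^ 2) ^ 3 = 1 := by rw [← pow_mul, h6]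
  have hi : (η ^ 2)⁻¹ = η ^ 4 := by
    rw [inv_eq_iff_mul_eq_one, ← pow_add, h6]
  have hψ2 := prim_shift hψ h2
  have a0 := hd2 hψ (η ^ 3) hφ h31 hall2 h2 χ
  have a1 := hd2 hψ (η ^ 3) hφ h31 hall2 h2 (η * χ)
  have a2 := hd2 hψ (η ^ 3) hφ h31 hall2 h2 (η ^ 2 * χ)
  have b := hd3 hψ2 (η ^ 2) hρ h21 hall3 h3 ζ hζ (χ ^ 2)
  rw [hi] at b
  rw [show (χ ^ 2) ^ 3 = χ ^ 6 by rw [← pow_mul], AddChar.mulShift_mulShift,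
    show (2 : F) * 3 = 6 by norm_num] at b
  rw [show χ * η ^ 3 = η ^ 3 * χ from mul_comm _ _] at a0
  rw [show η * χ * η ^ 3 = η ^ 4 * χ by rw [mul_right_comm, ← pow_succ'],
    show (η * χ) ^ 2 = χ ^ 2 * η ^ 2 by rw [mul_pow, mul_comm]] at a1
  rw [show η ^ 2 * χ * η ^ 3 = η ^ 5 * χ by rw [mul_right_comm, ← pow_add],
    show (η ^ 2 * χ) ^ 2 = χ ^ 2 * η ^ 4 by rw [mul_pow, mul_comm, ← pow_mul]] at a2
  simp only [Finset.prod_range_succ, Finset.prod_range_zero, pow_zero, one_mul, pow_one]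
  calc _ = (gaussSum χ ψ * gaussSum (η ^ 3 * χ) ψ) *
        (gaussSum (η * χ) ψ * gaussSum (η ^ 4 * χ) ψ) *
        (gaussSum (η ^ 2 * χ) ψ * gaussSum (η ^ 5 * χ) ψ) := by ring
    _ = _ := by
      rw [a0, a1, a2]
      linear_combination gaussSum (η ^ 3) ψ ^ 3 * b

/-- The additive character of the statement. -/
noncomputable def psi (p : ℕ) [Fact p.Prime] (F : Type) [Field F] [Algebra (ZMod p) F] :
    AddChar F ℂ :=
  (ZMod.stdAddChar (N := p)).compAddMonoidHom (Algebra.trace (ZMod p) F).toAddMonoidHom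

lemma psi_prim (p : ℕ) [Fact p.Prime] [Algebra (ZMod p) F] : (psi p F).IsPrimitive := by
  apply AddChar.IsPrimitive.of_ne_one
  have : FiniteDimensional (ZMod p) F := Module.Finite.of_finite
  obtain ⟨x, hx⟩ := Algebra.trace_surjective (ZMod p) F 1
  have h1 : ZMod.stdAddChar (N := p) ≠ 1 := by
    have := ZMod.isPrimitive_stdAddChar p one_ne_zero
    rwa [AddChar.mulShift_one] at this
  rw [AddChar.zmod_char_ne_one_iff] at h1
  rw [AddChar.ne_one_iff]
  refine ⟨x, ?_⟩
  change ZMod.stdAddChar (Algebra.trace (ZMod p) F x) ≠ 1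
  rwa [hx]

lemma gaussChar_eq (p : ℕ) [Fact p.Prime] [Algebra (ZMod p) F] (χ : MulChar F ℂ) :
    gaussChar p F χ = gaussSum χ (psi p F) := by
  unfold gaussChar gaussSum
  refine Finset.sum_congr rfl fun x _ => ?_
  congr 1
  change _ = ZMod.stdAddChar (Algebra.trace (ZMod p) F x)
  have := ZMod.stdAddChar_coe (N := p) ((Algebra.trace (ZMod p) F x).val : ℤ)
  rw [Int.cast_natCast, ZMod.natCast_zmod_val] at this
  rw [this]
  norm_cast

end HD

/-- Corollary of the Hasse–Davenport product relation for `m = 6`. -/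
theorem gauss_sixth_power_product (p e q t : ℕ) [Fact p.Prime] (F : Type) [Field F] [Fintype F]
    [Algebra (ZMod p) F]
    (he : 0 < e) (hq : q = Fintype.card F) (hqe : q = p ^ e) (hmod : q % 6 = 1)
    (ht : t = (q - 1) / 6)
    (ω : MulChar F ℂ) (hω : ∀ χ : MulChar F ℂ, ∃ j : ℕ, χ = ω ^ j) :
    ∀ j : ℤ, gaussChar p F (ω ^ (6 * j)) =
      (∏ i ∈ Finset.range 6, gaussChar p F (ω ^ (((i * t : ℕ) : ℤ) + j))) /
        ((ω ^ (-(6 * j))) ((6 : F)) * ∏ i ∈ Finset.Icc 1 5, gaussChar p F (ω ^ (i * t))) := by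
  intro j
  have hcard : 0 < Fintype.card F := Fintype.card_pos
  have hq1 : 1 < q := hq ▸ Fintype.one_lt_card
  have hqt : q = 6 * t + 1 := by omega
  have ht0 : 0 < t := by omega
  have h6F : (6 : F) ≠ 0 := by
    intro h
    have h0 : ((Fintype.card F : ℕ) : F) = 0 := FiniteField.cast_card_eq_zero F
    rw [← hq, hqt] at h0
    push_cast at h0
    rw [h] at h0
    simp at h0
  have h2F : (2 : F) ≠ 0 := fun h => h6F (by linear_combination 3 * h)
  have h3F : (3 : F) ≠ 0 := fun h => h6F (by linear_combination 2 * h)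
  obtain ⟨ζ, hζ⟩ : ∃ ζ : F, ζ ^ 2 + ζ + 1 = 0 := by
    have : Fact (Nat.Prime 3) := ⟨Nat.prime_three⟩
    obtain ⟨u, hu⟩ := exists_prime_orderOf_dvd_card (G := Fˣ) 3
      (by rw [Fintype.card_units, ← hq]; omega)
    refine ⟨u, ?_⟩
    have hu3 : (u : F) ^ 3 = 1 := by
      rw [← Units.val_pow_eq_pow_val, ← hu, pow_orderOf_eq_one, Units.val_one]
    have hu1 : (u : F) - 1 ≠ 0 := by
      intro h
      have : u = 1 := Units.ext (sub_eq_zero.1 h)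
      rw [this, orderOf_one] at hu
      omega
    apply mul_left_cancel₀ hu1
    linear_combination hu3
  have hord : orderOf ω = 6 * t := by
    rw [orderOf_eq_card_of_forall_mem_zpowers (g := ω)]
    · rw [MulChar.card_eq_card_units_of_hasEnoughRootsOfUnity F ℂ, Nat.card_eq_fintype_card,
        Fintype.card_units, ← hq]
      omega
    · intro χ
      obtain ⟨k, rfl⟩ := hω χ
      exact Subgroup.npow_mem_zpowers ω k
  have hone : ∀ n : ℕ, ω ^ n = 1 ↔ 6 * t ∣ n := fun n => by
    rw [← hord, orderOf_dvd_iff_pow_eq_one]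
  set η := ω ^ t with hη
  have h6 : η ^ 6 = 1 := by
    rw [hη, ← pow_mul, hone, mul_comm]
  have h31 : η ^ 3 ≠ 1 := by
    rw [hη, ← pow_mul, Ne, hone]
    intro h
    have := Nat.le_of_dvd (by omega) h
    omega
  have h21 : η ^ 2 ≠ 1 := by
    rw [hη, ← pow_mul, Ne, hone]
    intro h
    have := Nat.le_of_dvd (by omega) h
    omega
  have hall3 : ∀ χ : MulChar F ℂ, χ ^ 3 = 1 → χ = 1 ∨ χ = η ^ 2 ∨ χ = (η ^ 2)⁻¹ := by
    intro χ h
    obtain ⟨k, rfl⟩ := hω χ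
    rw [← pow_mul, hone] at h
    obtain ⟨l, hl⟩ := h
    have hk : k = t * (2 * l) := by linarith
    rw [inv_eq_of_mul_eq_one_left (a := η ^ 4) (b := η ^ 2) (by rw [← pow_add, h6]), hk,
      pow_mul, ← hη, pow_mul]
    have hm : (η ^ 2) ^ l = (η ^ 2) ^ (l % 3) := by
      rw [pow_eq_pow_mod l (by rw [← pow_mul, h6] : (η ^ 2) ^ 3 = 1)]
    rw [hm]
    have hl3 : l % 3 < 3 := Nat.mod_lt _ (by norm_num)
    interval_cases l % 3
    · exact Or.inl (pow_zero _)
    · exact Or.inr (Or.inl (pow_one _))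
    · exact Or.inr (Or.inr (by rw [← pow_mul]))
  have hall2 : ∀ χ : MulChar F ℂ, χ ^ 2 = 1 → χ = 1 ∨ χ = η ^ 3 := by
    intro χ h
    obtain ⟨k, rfl⟩ := hω χ
    rw [← pow_mul, hone] at h
    obtain ⟨l, hl⟩ := h
    have hk : k = t * (3 * l) := by linarith
    rw [hk, pow_mul, ← hη, pow_mul]
    have hm : (η ^ 3) ^ l = (η ^ 3) ^ (l % 2) := by
      rw [pow_eq_pow_mod l (by rw [← pow_mul, h6] : (η ^ 3) ^ 2 = 1)]
    rw [hm]
    have hl3 : l % 2 < 2 := Nat.mod_lt _ (by norm_num)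
    interval_cases l % 2
    · exact Or.inl (pow_zero _)
    · exact Or.inr (pow_one _)
  have hψ := HD.psi_prim (F := F) p
  have main := HD.hd6 hψ η h6 h31 h21 hall3 hall2 h2F h3F ζ hζ
  simp_rw [HD.gaussChar_eq]
  set ψ := HD.psi p F with hψdef
  have hg0 : gaussSum (η ^ 3) ψ ≠ 0 :=
    gaussSum_ne_zero_of_nontrivial (by exact_mod_cast hcard.ne') h31 hψ
  have hD : ∏ i ∈ Finset.Icc 1 5, gaussSum (ω ^ (i * t)) ψ =
      gaussSum (η ^ 3) ψ ^ 3 * Fintype.card F := by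
    have m1 := main 1
    rw [one_pow, gaussSum_one_left (HD.prim_ne_one (HD.prim_shift hψ h6F)),
      Finset.prod_range_succ', pow_zero, mul_one, gaussSum_one_left (HD.prim_ne_one hψ)] at m1
    have hre : ∏ i ∈ Finset.Icc 1 5, gaussSum (ω ^ (i * t)) ψ =
        ∏ k ∈ Finset.range 5, gaussSum (η ^ (k + 1) * 1) ψ := by
      rw [← Finset.Ico_succ_right_eq_Icc, Finset.prod_Ico_eq_prod_range]
      refine Finset.prod_congr rfl fun k _ => ?_
      rw [mul_one, hη, ← pow_mul, mul_comm t, add_comm]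
    rw [hre]
    linear_combination -m1
  have hN : ∏ i ∈ Finset.range 6, gaussSum (ω ^ (((i * t : ℕ) : ℤ) + j)) ψ =
      gaussSum (η ^ 3) ψ ^ 3 * Fintype.card F *
        ((ω ^ (-(6 * j))) (6 : F) * gaussSum (ω ^ (6 * j)) ψ) := by
    have m := main (ω ^ j)
    have e6 : (ω ^ j) ^ 6 = ω ^ (6 * j) := by
      rw [mul_comm, zpow_mul]
      rfl
    have hs := gaussSum_mulShift_eq (ω ^ (6 * j)) ψ (Units.mk0 (6 : F) h6F)
    rw [Units.val_mk0] at hs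
    rw [e6, hs, ← zpow_neg] at m
    rw [← m]
    refine Finset.prod_congr rfl fun i _ => ?_
    rw [zpow_add, zpow_natCast, mul_comm i, pow_mul]
  have hu : (ω ^ (-(6 * j))) (6 : F) ≠ 0 :=
    ((h6F.isUnit).map (ω ^ (-(6 * j)))).ne_zero
  rw [hN, hD, eq_div_iff]
  · ring
  · exact mul_ne_zero hu (mul_ne_zero (pow_ne_zero 3 hg0) (by exact_mod_cast hcard.ne'))
end

section
/- Let q = p^e be a power of a prime with q ≡ 1 (mod 6) and t = (q-1)/6. For every λ ∈ 𝔽_q with λ ≠ 0 and λ⁶ ≠ 1, the number of 𝔽_q-rational points on the Dwork hypersurface X_λ⁶ satisfies #X_λ⁶(𝔽_q) = Σ_{w∈W} N_q(0,w) + (1/(q-1))·Σ_{[w]∈W/∼} Σ_{j=0}^{q-2} (∏_{i=1}^{6} g(ω^{w_i t + j}) / g(ω^{6j}))·ω^{6j}(6λ), where the inner product of Gauss sums is independent of the chosen representative of the class [w]. -/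
open scoped Classical

section DworkHelpers

variable {F : Type} [Field F] [Fintype F]

lemma dwk_card_sub_ne : (Fintype.card F : ℂ) - 1 ≠ 0 := by
  have := Fintype.one_lt_card (α := F)
  rw [sub_ne_zero]
  exact_mod_cast this.ne'

lemma dwk_card_ne : (Fintype.card F : ℂ) ≠ 0 := by
  exact_mod_cast Fintype.card_ne_zero

lemma dwk_sum_x (χ : MulChar F ℂ) :
    ∑ x : F, χ x = if χ = 1 then (Fintype.card F : ℂ) - 1 else 0 := by
  split_ifs with h
  · subst h
    rw [MulChar.sum_one_eq_card_units, Fintype.card_units, Nat.cast_sub Fintype.card_pos]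
    simp
  · exact MulChar.sum_eq_zero_of_ne_one h

lemma dwk_nat_card : Nat.card (MulChar F ℂ) = Fintype.card F - 1 := by
  rw [MulChar.card_eq_card_units_of_hasEnoughRootsOfUnity, Nat.card_eq_fintype_card,
    Fintype.card_units]

lemma dwk_sum_chi [Fintype (MulChar F ℂ)] (a : F) :
    ∑ χ : MulChar F ℂ, χ a = if a = 1 then (Fintype.card F : ℂ) - 1 else 0 := by
  split_ifs with h
  · subst h
    have := dwk_nat_card (F := F)
    rw [Nat.card_eq_fintype_card] at this
    simp [this, Nat.cast_sub Fintype.card_pos]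
  · obtain ⟨χ₀, h0⟩ := MulChar.exists_apply_ne_one_of_hasEnoughRootsOfUnity F ℂ h
    have : ∑ χ : MulChar F ℂ, χ a = χ₀ a * ∑ χ : MulChar F ℂ, χ a := by
      rw [Finset.mul_sum]
      exact (Fintype.sum_equiv (Equiv.mulLeft χ₀) _ _ (fun χ => by simp)).symm
    have h2 : (1 - χ₀ a) * ∑ χ : MulChar F ℂ, χ a = 0 := by linear_combination this
    rcases mul_eq_zero.1 h2 with h3 | h3
    · exact absurd (by linear_combination -h3) h0
    · exact h3

variable {ψ : AddChar F ℂ}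

lemma dwk_fourier [Fintype (MulChar F ℂ)] (ψ : AddChar F ℂ) {u : F} (hu : u ≠ 0) :
    ∑ χ : MulChar F ℂ, gaussSum χ ψ * χ⁻¹ u = ((Fintype.card F : ℂ) - 1) * ψ u := by
  simp only [gaussSum, Finset.sum_mul]
  rw [Finset.sum_comm]
  have : ∀ x : F, ∑ χ : MulChar F ℂ, χ x * ψ x * χ⁻¹ u
      = if x = u then ((Fintype.card F : ℂ) - 1) * ψ u else 0 := by
    intro x
    have h1 : ∀ χ : MulChar F ℂ, χ x * ψ x * χ⁻¹ u = ψ x * χ (x * u⁻¹) := by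
      intro χ
      rw [MulChar.inv_apply', map_mul]; ring
    simp only [h1]
    rw [← Finset.mul_sum, dwk_sum_chi]
    by_cases hx : x = u
    · subst hx; simp [hu, mul_comm]
    · have : x * u⁻¹ ≠ 1 := by
        intro h; exact hx ((mul_inv_eq_one₀ hu).1 h)
      simp [this, hx]
  simp [this]

lemma dwk_gauss_one (hψ : ψ.IsPrimitive) : gaussSum (1 : MulChar F ℂ) ψ = -1 := by
  have : ψ ≠ 1 := by
    intro h
    have := hψ (a := 1) one_ne_zero
    subst h
    apply this
    ext; simp
  rw [gaussSum_one_left this]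

lemma dwk_gauss_inv (hψ : ψ.IsPrimitive) (χ : MulChar F ℂ) (hχ : χ ≠ 1) :
    gaussSum χ⁻¹ ψ = Fintype.card F * χ (-1) / gaussSum χ ψ := by
  have h := gaussSum_mul_gaussSum_eq_card hχ hψ
  have h2 := mul_gaussSum_inv_eq_gaussSum χ⁻¹ ψ
  have h0 : gaussSum χ ψ ≠ 0 := by
    intro h0; rw [h0, zero_mul] at h; exact dwk_card_ne (F := F) h.symm
  rw [← h2, eq_div_iff h0, MulChar.inv_apply']
  rw [← h]
  have : (-1 : F)⁻¹ = -1 := by norm_num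
  rw [this]; ring

lemma dwk_psi_sub [Fintype (MulChar F ℂ)] (hψ : ψ.IsPrimitive) (y : F) :
    ((Fintype.card F : ℂ) - 1) * (ψ y - 1)
      = Fintype.card F * ∑ χ : MulChar F ℂ, χ (-y) / gaussSum χ ψ := by
  by_cases hy : y = 0
  · subst hy; simp [MulChar.map_zero]
  rw [mul_sub, ← dwk_fourier ψ hy, Finset.mul_sum,
    ← Equiv.sum_comp (Equiv.inv (MulChar F ℂ))]
  simp only [Equiv.inv_apply, inv_inv]
  rw [← sub_eq_zero, sub_right_comm, ← Finset.sum_sub_distrib, sub_eq_zero]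
  rw [Finset.sum_eq_single 1]
  · have h1 : (1 : MulChar F ℂ) y = 1 := MulChar.one_apply (isUnit_iff_ne_zero.2 hy)
    have h2 : (1 : MulChar F ℂ) (-y) = 1 := MulChar.one_apply (isUnit_iff_ne_zero.2 (by simpa))
    rw [inv_one, dwk_gauss_one hψ, h1, h2]; ring
  · intro χ _ hχ
    rw [dwk_gauss_inv hψ χ hχ, ← neg_one_mul y, map_mul]
    ring
  · simp

/-- The twisted sum over sixth powers. -/
lemma dwk_inner [Fintype (MulChar F ℂ)] (ψ : AddChar F ℂ) (χ : MulChar F ℂ) {a : F}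
    (ha : a ≠ 0) :
    ∑ x : F, χ x * ψ (a * x ^ 6)
      = ∑ η ∈ Finset.univ.filter (fun η : MulChar F ℂ => η ^ 6 = χ),
          gaussSum η ψ * η⁻¹ a := by
  apply mul_left_cancel₀ (dwk_card_sub_ne (F := F))
  have h1 : ∀ x : F, ((Fintype.card F : ℂ) - 1) * (χ x * ψ (a * x ^ 6))
      = ∑ η : MulChar F ℂ, (gaussSum η ψ * η⁻¹ a) * (χ * (η ^ 6)⁻¹) x := by
    intro x
    by_cases hx : x = 0
    · subst hx; simp [MulChar.map_zero]
    · rw [mul_left_comm, ← dwk_fourier ψ (mul_ne_zero ha (pow_ne_zero 6 hx)), Finset.mul_sum]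
      refine Finset.sum_congr rfl fun η _ => ?_
      rw [MulChar.mul_apply, map_mul, map_pow, ← inv_pow, MulChar.pow_apply' _ (by norm_num)]
      ring
  rw [Finset.mul_sum, Finset.sum_congr rfl (fun x _ => h1 x), Finset.sum_comm, Finset.sum_filter,
    Finset.mul_sum]
  refine Finset.sum_congr rfl fun η _ => ?_
  rw [← Finset.mul_sum, dwk_sum_x]
  have : χ * (η ^ 6)⁻¹ = 1 ↔ η ^ 6 = χ := by rw [mul_inv_eq_one, eq_comm]
  simp only [this]
  split_ifs <;> ring

lemma dwk_prod_apply {ι : Type*} (s : Finset ι) (f : ι → MulChar F ℂ) {a : F} (ha : a ≠ 0) :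
    (∏ i ∈ s, f i) a = ∏ i ∈ s, f i a := by
  induction s using Finset.induction_on with
  | empty => simpa using MulChar.one_apply (isUnit_iff_ne_zero.2 ha)
  | insert i s hi ih => rw [Finset.prod_insert hi, Finset.prod_insert hi, MulChar.mul_apply, ih]

/-- Number of affine solutions. -/
noncomputable def dwkN (c : F) : ℂ :=
  ((Finset.univ.filter (fun v : Fin 6 → F => ∑ i, v i ^ 6 = c * ∏ i, v i)).card : ℂ)

lemma dwk_count (hψ : ψ.IsPrimitive) (c : F) :
    (Fintype.card F : ℂ) * dwkN c
      = ∑ a : F, ∑ v : Fin 6 → F, ψ (a * ∑ i, v i ^ 6) * ψ (-(a * (c * ∏ i, v i))) := by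
  rw [Finset.sum_comm, dwkN, Finset.card_filter, Nat.cast_sum, Finset.mul_sum]
  refine Finset.sum_congr rfl fun v _ => ?_
  have := AddChar.sum_mulShift (∑ i, v i ^ 6 - c * ∏ i, v i) hψ
  have h2 : ∀ a : F, ψ (a * ∑ i, v i ^ 6) * ψ (-(a * (c * ∏ i, v i)))
      = ψ (a * (∑ i, v i ^ 6 - c * ∏ i, v i)) := by
    intro a
    rw [← AddChar.map_add_eq_mul, mul_sub, sub_eq_add_neg]
  simp only [h2]
  rw [this]
  simp only [sub_eq_zero]
  split_ifs <;> simp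

lemma dwk_psi_sum (ψ : AddChar F ℂ) (a : F) (v : Fin 6 → F) :
    ψ (a * ∑ i, v i ^ 6) = ∏ i, ψ (a * v i ^ 6) := by
  rw [Finset.mul_sum]
  generalize (Finset.univ : Finset (Fin 6)) = s
  induction s using Finset.induction_on with
  | empty => simp
  | insert i s hi ih =>
    rw [Finset.prod_insert hi, Finset.sum_insert hi, AddChar.map_add_eq_mul, ih]

/-- The difference between the deformed and the Fermat count. -/
lemma dwk_diff [Fintype (MulChar F ℂ)] (hψ : ψ.IsPrimitive) (c : F) :
    dwkN c - dwkN (0 : F)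
      = ∑ η ∈ Finset.univ.filter (fun η : Fin 6 → MulChar F ℂ => ∀ i, η i ^ 6 = ∏ k, η k),
          (∏ i, gaussSum (η i) ψ) / gaussSum (∏ i, η i) ψ * (∏ i, η i) c := by
  apply mul_left_cancel₀ (dwk_card_ne (F := F))
  apply mul_left_cancel₀ (dwk_card_sub_ne (F := F))
  rw [mul_sub, dwk_count hψ, dwk_count hψ, ← Finset.sum_sub_distrib]
  simp only [← Finset.sum_sub_distrib]
  have h1 : ∀ (a : F) (v : Fin 6 → F), ((Fintype.card F : ℂ) - 1) *
      (ψ (a * ∑ i, v i ^ 6) * ψ (-(a * (c * ∏ i, v i)))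
        - ψ (a * ∑ i, v i ^ 6) * ψ (-(a * (0 * ∏ i, v i))))
      = Fintype.card F * ∑ χ : MulChar F ℂ, χ c / gaussSum χ ψ *
          (χ a * ∏ i, (χ (v i) * ψ (a * v i ^ 6))) := by
    intro a v
    rw [zero_mul, mul_zero, neg_zero, AddChar.map_zero_eq_one, ← mul_sub, mul_left_comm,
      dwk_psi_sub hψ, mul_left_comm, Finset.mul_sum]
    congr 1
    refine Finset.sum_congr rfl fun χ _ => ?_
    rw [neg_neg, map_mul χ, map_mul χ, map_prod χ, Finset.prod_mul_distrib, dwk_psi_sum]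
    ring
  have h2 : ∀ (χ : MulChar F ℂ) (a : F),
      ∑ v : Fin 6 → F, χ a * ∏ i, (χ (v i) * ψ (a * v i ^ 6))
      = ∑ η ∈ Finset.univ.filter (fun η : Fin 6 → MulChar F ℂ => ∀ i, η i ^ 6 = χ),
        (∏ i, gaussSum (η i) ψ) * (χ * (∏ i, η i)⁻¹) a := by
    intro χ a
    by_cases ha : a = 0
    · subst ha; simp [MulChar.map_zero]
    rw [← Finset.mul_sum]
    have h3 := Finset.prod_univ_sum (fun _ : Fin 6 => (Finset.univ : Finset F))
      (fun _ x => χ x * ψ (a * x ^ 6))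
    rw [Fintype.piFinset_univ] at h3
    rw [← h3]
    simp only [dwk_inner ψ χ ha]
    rw [Finset.prod_univ_sum, Finset.mul_sum]
    refine Finset.sum_congr ?_ fun η _ => ?_
    · ext η; simp [Fintype.mem_piFinset]
    · rw [Finset.prod_mul_distrib, MulChar.mul_apply, ← Finset.prod_inv_distrib,
        dwk_prod_apply _ _ ha]
      ring
  rw [Finset.mul_sum]
  simp only [Finset.mul_sum Finset.univ _ ((Fintype.card F : ℂ) - 1)]
  simp only [h1]
  simp only [← Finset.mul_sum Finset.univ _ (Fintype.card F : ℂ)]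
  rw [mul_left_comm]
  congr 1
  have h4 : ∀ a : F, ∑ v : Fin 6 → F, ∑ χ : MulChar F ℂ, χ c / gaussSum χ ψ *
          (χ a * ∏ i, (χ (v i) * ψ (a * v i ^ 6)))
      = ∑ χ : MulChar F ℂ, χ c / gaussSum χ ψ *
        ∑ η ∈ Finset.univ.filter (fun η : Fin 6 → MulChar F ℂ => ∀ i, η i ^ 6 = χ),
        (∏ i, gaussSum (η i) ψ) * (χ * (∏ i, η i)⁻¹) a := by
    intro a
    rw [Finset.sum_comm]
    refine Finset.sum_congr rfl fun χ _ => ?_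
    rw [← Finset.mul_sum, h2]
  simp only [h4]
  rw [Finset.sum_comm]
  have h5 : ∀ χ : MulChar F ℂ, ∑ a : F, χ c / gaussSum χ ψ *
        ∑ η ∈ Finset.univ.filter (fun η : Fin 6 → MulChar F ℂ => ∀ i, η i ^ 6 = χ),
        (∏ i, gaussSum (η i) ψ) * (χ * (∏ i, η i)⁻¹) a
      = ∑ η : Fin 6 → MulChar F ℂ, if χ = ∏ i, η i then
          (if ∀ i, η i ^ 6 = ∏ k, η k then
            ((Fintype.card F : ℂ) - 1) * ((∏ i, gaussSum (η i) ψ) /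
              gaussSum (∏ i, η i) ψ * (∏ i, η i) c) else 0) else 0 := by
    intro χ
    rw [← Finset.mul_sum, Finset.sum_comm, Finset.sum_filter, Finset.mul_sum]
    refine Finset.sum_congr rfl fun η _ => ?_
    rw [← Finset.mul_sum, dwk_sum_x]
    simp only [mul_inv_eq_one]
    by_cases h : χ = ∏ i, η i
    · rw [if_pos h, if_pos h, h]
      split_ifs <;> ring
    · rw [if_neg h, if_neg h]; simp
  simp only [h5]
  rw [Finset.sum_comm]
  simp only [Finset.sum_ite_eq', Finset.sum_ite_eq, Finset.mem_univ, if_true]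
  rw [Finset.sum_filter, Finset.mul_sum]
  refine Finset.sum_congr rfl fun η _ => ?_
  split_ifs <;> ring

/-- The Fermat count. -/
lemma dwk_fermat [Fintype (MulChar F ℂ)] (hψ : ψ.IsPrimitive) :
    (Fintype.card F : ℂ) * dwkN (0 : F)
      = (Fintype.card F : ℂ) ^ 6 + ((Fintype.card F : ℂ) - 1) *
        ∑ η ∈ Finset.univ.filter (fun η : Fin 6 → MulChar F ℂ =>
          (∀ i, η i ^ 6 = 1 ∧ η i ≠ 1) ∧ ∏ k, η k = 1), ∏ i, gaussSum (η i) ψ := by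
  rw [dwk_count hψ]
  simp only [zero_mul, mul_zero, neg_zero, AddChar.map_zero_eq_one, mul_one]
  have h0 : ∀ a : F, a ≠ 0 → ∑ x : F, ψ (a * x ^ 6)
      = ∑ η ∈ Finset.univ.filter (fun η : MulChar F ℂ => η ^ 6 = 1 ∧ η ≠ 1),
          gaussSum η ψ * η⁻¹ a := by
    intro a ha
    have h := dwk_inner ψ 1 ha
    have e1 : ∑ x : F, ψ (a * x ^ 6) = 1 + ∑ x : F, (1 : MulChar F ℂ) x * ψ (a * x ^ 6) := by
      rw [← Finset.add_sum_erase _ _ (Finset.mem_univ (0 : F)),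
        ← Finset.add_sum_erase Finset.univ (fun x : F => (1 : MulChar F ℂ) x * ψ (a * x ^ 6))
          (Finset.mem_univ (0 : F))]
      have : ∀ x ∈ Finset.univ.erase (0 : F), (1 : MulChar F ℂ) x * ψ (a * x ^ 6)
          = ψ (a * x ^ 6) := by
        intro x hx
        rw [MulChar.one_apply (isUnit_iff_ne_zero.2 (Finset.ne_of_mem_erase hx)), one_mul]
      rw [Finset.sum_congr rfl this]
      simp [MulChar.map_zero]
    rw [e1, h, Finset.sum_filter, Finset.sum_filter,
      ← Finset.add_sum_erase _ _ (Finset.mem_univ (1 : MulChar F ℂ)),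
      ← Finset.add_sum_erase Finset.univ
        (fun η : MulChar F ℂ => if η ^ 6 = 1 ∧ η ≠ 1 then gaussSum η ψ * η⁻¹ a else 0)
        (Finset.mem_univ (1 : MulChar F ℂ))]
    have : ∀ η ∈ Finset.univ.erase (1 : MulChar F ℂ),
        (if η ^ 6 = 1 ∧ η ≠ 1 then gaussSum η ψ * η⁻¹ a else 0)
          = if η ^ 6 = 1 then gaussSum η ψ * η⁻¹ a else 0 := by
      intro η hη
      simp [Finset.ne_of_mem_erase hη]
    rw [Finset.sum_congr rfl this]
    simp [dwk_gauss_one hψ, MulChar.one_apply (isUnit_iff_ne_zero.2 ha)]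
    ring
  rw [← Finset.add_sum_erase _ _ (Finset.mem_univ (0 : F))]
  congr 1
  · simp
  · have h2 : ∀ a ∈ Finset.univ.erase (0 : F), ∑ v : Fin 6 → F, ψ (a * ∑ i, v i ^ 6)
        = ∑ η ∈ Finset.univ.filter (fun η : Fin 6 → MulChar F ℂ =>
          (∀ i, η i ^ 6 = 1 ∧ η i ≠ 1)), (∏ i, gaussSum (η i) ψ) * ((∏ i, η i)⁻¹) a := by
      intro a ha
      replace ha := Finset.ne_of_mem_erase ha
      simp only [dwk_psi_sum]
      have h3 := Finset.prod_univ_sum (fun _ : Fin 6 => (Finset.univ : Finset F))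
        (fun _ x => ψ (a * x ^ 6))
      rw [Fintype.piFinset_univ] at h3
      rw [← h3]
      simp only [h0 a ha]
      rw [Finset.prod_univ_sum]
      refine Finset.sum_congr ?_ fun η _ => ?_
      · ext η; simp [Fintype.mem_piFinset]
      · rw [Finset.prod_mul_distrib, ← Finset.prod_inv_distrib, dwk_prod_apply _ _ ha]
    rw [Finset.sum_congr rfl h2, Finset.sum_comm, ← Finset.filter_filter,
      Finset.sum_filter (fun η : Fin 6 → MulChar F ℂ => ∏ k, η k = 1), Finset.mul_sum]
    refine Finset.sum_congr rfl fun η _ => ?_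
    rw [← Finset.mul_sum]
    have h4 := dwk_sum_x ((∏ i, η i)⁻¹)
    rw [← Finset.add_sum_erase _ _ (Finset.mem_univ (0 : F)), MulChar.map_zero, zero_add] at h4
    rw [h4]
    simp only [inv_eq_one]
    split_ifs <;> ring

/-- The affine equation is invariant under scaling by a nonzero scalar. -/
lemma dwk_scale (c u : F) (hu : u ≠ 0) (v : Fin 6 → F) :
    (∑ i, (u * v i) ^ 6 = c * ∏ i, (u * v i)) ↔ ∑ i, v i ^ 6 = c * ∏ i, v i := by
  have h1 : ∑ i, (u * v i) ^ 6 = u ^ 6 * ∑ i, v i ^ 6 := by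
    rw [Finset.mul_sum]; simp only [mul_pow]
  have h2 : c * ∏ i, (u * v i) = u ^ 6 * (c * ∏ i, v i) := by
    rw [Finset.prod_mul_distrib]; simp; ring
  rw [h1, h2]
  exact mul_right_inj' (pow_ne_zero 6 hu)

/-- Passing from affine to projective points. -/
lemma dwk_proj (lam : F) :
    (dworkCount F 6 lam : ℂ) * ((Fintype.card F : ℂ) - 1) = dwkN ((6 : ℕ) * lam) - 1 := by
  set c : F := (6 : ℕ) * lam with hc
  let A := {P : Projectivization F (Fin 6 → F) // ∑ i, P.rep i ^ 6 = c * ∏ i, P.rep i}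
  let B := {v : Fin 6 → F // v ≠ 0 ∧ ∑ i, v i ^ 6 = c * ∏ i, v i}
  let f : A × Fˣ → B := fun x => ⟨fun i => (x.2 : F) * x.1.1.rep i, by
    intro h
    apply x.1.1.rep_nonzero
    ext i
    have := congrFun h i
    simpa using this, (dwk_scale c _ x.2.ne_zero _).2 x.1.2⟩
  have hf : Function.Bijective f := by
    constructor
    · rintro ⟨⟨P, hP⟩, u⟩ ⟨⟨Q, hQ⟩, w⟩ h
      have h' : ∀ i, (u : F) * P.rep i = (w : F) * Q.rep i := fun i =>
        congrFun (congrArg Subtype.val h) i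
      have hPQ : P = Q := by
        rw [← P.mk_rep, ← Q.mk_rep, Projectivization.mk_eq_mk_iff]
        refine ⟨u⁻¹ * w, ?_⟩
        ext i
        simp only [Pi.smul_apply, Units.smul_def, Units.val_mul, smul_eq_mul, mul_assoc, ← h']
        simp
      subst hPQ
      have : u = w := by
        by_contra hne
        apply P.rep_nonzero
        ext i
        have h3 : ((u : F) - w) * P.rep i = 0 := by linear_combination h' i
        rcases mul_eq_zero.1 h3 with h4 | h4
        · exact absurd (Units.ext (sub_eq_zero.1 h4)) hne
        · exact h4
      rw [this]
    · rintro ⟨v, hv, hv2⟩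
      obtain ⟨a, ha⟩ := Projectivization.exists_smul_eq_mk_rep F v hv
      have ha' : ∀ i, (Projectivization.mk F v hv).rep i = (a : F) * v i := fun i => by
        rw [← ha]; rfl
      refine ⟨⟨⟨Projectivization.mk F v hv, ?_⟩, a⁻¹⟩, ?_⟩
      · simp only [ha']
        exact (dwk_scale c _ a.ne_zero _).2 hv2
      · apply Subtype.ext
        ext i
        simp [f, ha']
  have hcard := Nat.card_congr (Equiv.ofBijective f hf)
  rw [Nat.card_prod] at hcard
  have hu : (Nat.card Fˣ : ℂ) = (Fintype.card F : ℂ) - 1 := by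
    rw [Nat.card_eq_fintype_card, Fintype.card_units, Nat.cast_sub Fintype.card_pos]; simp
  have hA : dworkCount F 6 lam = Nat.card A := rfl
  have hB : (Nat.card B : ℂ) = dwkN c - 1 := by
    have e1 : Nat.card B = ((Finset.univ.filter
        (fun v : Fin 6 → F => ∑ i, v i ^ 6 = c * ∏ i, v i)).erase 0).card := by
      rw [Nat.card_eq_fintype_card, Fintype.card_subtype]
      congr 1
      ext v; simp
    rw [e1, Finset.card_erase_of_mem (by simp), Nat.cast_sub, dwkN]
    · simp
    · exact Finset.card_pos.2 ⟨0, by simp⟩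
  rw [hA, ← hu, ← hB, ← hcard]
  push_cast
  rfl

end DworkHelpers

lemma dwk_gaussChar (p : ℕ) [Fact p.Prime] (F : Type) [Field F] [Fintype F]
    [Algebra (ZMod p) F] :
    ∃ ψ : AddChar F ℂ, ψ.IsPrimitive ∧ ∀ χ : MulChar F ℂ, gaussChar p F χ = gaussSum χ ψ := by
  let ψ : AddChar F ℂ := (ZMod.stdAddChar (N := p)).compAddMonoidHom
    (Algebra.trace (ZMod p) F).toAddMonoidHom
  refine ⟨ψ, AddChar.IsPrimitive.of_ne_one ?_, fun χ => ?_⟩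
  · intro h
    have : FiniteDimensional (ZMod p) F := Module.Finite.of_finite
    obtain ⟨x, hx⟩ := Algebra.trace_surjective (ZMod p) F 1
    have h1 : ψ x = 1 := by rw [h]; simp
    have h2 : ZMod.stdAddChar (N := p) 1 = ZMod.stdAddChar (N := p) 0 := by
      rw [AddChar.map_zero_eq_one, ← h1, ← hx]; rfl
    exact one_ne_zero (ZMod.injective_stdAddChar h2)
  · unfold gaussChar gaussSum
    refine Finset.sum_congr rfl fun x _ => ?_
    congr 1
    rw [← ZMod.toCircle_apply]
    rfl

section DworkBij

variable {F : Type} [Field F] [Fintype F] {ω : MulChar F ℂ} {t : ℕ}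

lemma dwk_dvd_iff (w : ZMod 6) (m : ℤ) : (6 : ℤ) ∣ (w.val : ℤ) - m ↔ w = (m : ZMod 6) := by
  have h := ZMod.intCast_zmod_eq_zero_iff_dvd ((w.val : ℤ) - m) 6
  rw [Nat.cast_ofNat] at h
  rw [← h]
  push_cast
  rw [ZMod.natCast_zmod_val, sub_eq_zero]

lemma dwk_val_sum (w : Fin 6 → ZMod 6) (h : ∑ i, w i = 0) : 6 ∣ ∑ i, (w i).val := by
  rw [← ZMod.natCast_eq_zero_iff]
  push_cast
  simpa using h

lemma dwk_pow (h6 : orderOf ω = 6 * t) (a b : ℕ) :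
    ω ^ a = ω ^ b ↔ (6 * t : ℤ) ∣ (b : ℤ) - a := by
  rw [pow_eq_pow_iff_modEq, h6, Nat.modEq_iff_dvd]
  push_cast; rfl

lemma dwk_pow_one (h6 : orderOf ω = 6 * t) (a : ℕ) :
    ω ^ a = 1 ↔ (6 * t : ℤ) ∣ (a : ℤ) := by
  rw [← orderOf_dvd_iff_pow_eq_one, h6]
  exact_mod_cast Iff.rfl

lemma dwk_prod_pow (h6 : orderOf ω = 6 * t) (w : Fin 6 → ZMod 6) (h : ∑ i, w i = 0) (j : ℕ) :
    ∏ i, ω ^ ((w i).val * t + j) = ω ^ (6 * j) := by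
  rw [Finset.prod_pow_eq_pow_sum, Finset.sum_add_distrib, ← Finset.sum_mul]
  obtain ⟨m, hm⟩ := dwk_val_sum w h
  rw [hm, dwk_pow h6]
  refine ⟨-m, ?_⟩
  simp
  ring

lemma dwk_pow_six (h6 : orderOf ω = 6 * t) (a j : ℕ) :
    (ω ^ (a * t + j)) ^ 6 = ω ^ (6 * j) := by
  rw [← pow_mul, dwk_pow h6]
  refine ⟨-a, ?_⟩
  push_cast; ring

lemma dwk_bij1 [Fintype (MulChar F ℂ)] (h6 : orderOf ω = 6 * t) (ht : 0 < t) (hω : ∀ χ : MulChar F ℂ, ∃ j : ℕ, χ = ω ^ j)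
    (f : (Fin 6 → MulChar F ℂ) → ℂ) :
    ∑ w ∈ Finset.univ.filter (fun w : Fin 6 → ZMod 6 => ∑ i, w i = 0 ∧ ∀ i, w i ≠ 0),
      f (fun i => ω ^ ((w i).val * t))
    = ∑ η ∈ Finset.univ.filter (fun η : Fin 6 → MulChar F ℂ =>
          (∀ i, η i ^ 6 = 1 ∧ η i ≠ 1) ∧ ∏ k, η k = 1), f η := by
  have ht0 : (t : ℤ) ≠ 0 := by exact_mod_cast ht.ne'
  refine Finset.sum_bij (fun w _ => fun i => ω ^ ((w i).val * t)) ?_ ?_ ?_ ?_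
  · intro w hw
    simp only [Finset.mem_filter, Finset.mem_univ, true_and] at hw ⊢
    refine ⟨fun i => ⟨?_, ?_⟩, ?_⟩
    · simpa using dwk_pow_six h6 (w i).val 0
    · intro h
      rw [dwk_pow_one h6] at h
      push_cast at h
      have h3 := (mul_dvd_mul_iff_right ht0).1 h
      have := (dwk_dvd_iff (w i) 0).1 (by simpa using h3)
      exact hw.2 i (by simpa using this)
    · simpa using dwk_prod_pow h6 w hw.1 0
  · intro w _ w' _ h
    ext1 i
    have := congrFun h i
    rw [dwk_pow h6] at this
    push_cast at this
    rw [← sub_mul] at this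
    have h3 := (dwk_dvd_iff _ _).1 ((mul_dvd_mul_iff_right ht0).1 this)
    simpa using h3.symm
  · intro η hη
    simp only [Finset.mem_filter, Finset.mem_univ, true_and] at hη
    choose e he using fun i => hω (η i)
    have h1 : ∀ i, ∃ m : ℤ, (e i : ℤ) = t * m := by
      intro i
      have := (hη.1 i).1
      rw [he, ← pow_mul, dwk_pow_one h6] at this
      push_cast at this
      rw [mul_comm (e i : ℤ)] at this
      exact (mul_dvd_mul_iff_left (by norm_num : (6 : ℤ) ≠ 0)).1 this
    choose m hm using h1
    have hη' : ∀ i, ω ^ (((m i : ZMod 6)).val * t) = η i := by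
      intro i
      rw [he i, eq_comm, dwk_pow h6]
      push_cast
      rw [hm i, mul_comm (t : ℤ) (m i), ← sub_mul]
      exact mul_dvd_mul_right ((dwk_dvd_iff _ _).2 rfl) _
    refine ⟨fun i => (m i : ZMod 6), ?_, funext hη'⟩
    simp only [Finset.mem_filter, Finset.mem_univ, true_and]
    constructor
    · have := hη.2
      simp only [he] at this
      rw [Finset.prod_pow_eq_pow_sum, dwk_pow_one h6] at this
      push_cast at this
      simp only [hm] at this
      rw [← Finset.mul_sum, mul_comm] at this
      have h3 := (mul_dvd_mul_iff_left ht0).1 this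
      rw [← Int.cast_sum]
      exact (ZMod.intCast_zmod_eq_zero_iff_dvd _ 6).2 h3
    · intro i h
      apply (hη.1 i).2
      rw [← hη' i, h]; simp
  · intro w _; rfl

lemma dwk_bij2 [Fintype (MulChar F ℂ)] (h6 : orderOf ω = 6 * t) (ht : 0 < t) (hω : ∀ χ : MulChar F ℂ, ∃ j : ℕ, χ = ω ^ j)
    (R : Finset (Fin 6 → ZMod 6)) (hR1 : ∀ w ∈ R, ∑ i, w i = 0)
    (hR2 : ∀ w : Fin 6 → ZMod 6, ∑ i, w i = 0 →
      ∃! w', w' ∈ R ∧ ∃ k : ZMod 6, w = w' + fun _ => k)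
    (f : (Fin 6 → MulChar F ℂ) → ℂ) :
    ∑ x ∈ R ×ˢ Finset.range (6 * t), f (fun i => ω ^ ((x.1 i).val * t + x.2))
    = ∑ η ∈ Finset.univ.filter (fun η : Fin 6 → MulChar F ℂ => ∀ i, η i ^ 6 = ∏ k, η k), f η := by
  have ht0 : (t : ℤ) ≠ 0 := by exact_mod_cast ht.ne'
  refine Finset.sum_bij (fun x _ => fun i => ω ^ ((x.1 i).val * t + x.2)) ?_ ?_ ?_ ?_
  · rintro ⟨w, j⟩ hx
    simp only [Finset.mem_product, Finset.mem_range] at hx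
    simp only [Finset.mem_filter, Finset.mem_univ, true_and]
    intro i
    rw [dwk_pow_six h6, dwk_prod_pow h6 w (hR1 w hx.1)]
  · rintro ⟨w, j⟩ hx ⟨w', j'⟩ hx' h
    simp only [Finset.mem_product, Finset.mem_range] at hx hx'
    have h1 : ∀ i, (6 * t : ℤ) ∣ ((w' i).val * t + j') - ((w i).val * t + j) := by
      intro i
      have := congrFun h i
      simp only at this
      rw [dwk_pow h6] at this
      exact_mod_cast this
    have h2 : (t : ℤ) ∣ (j' : ℤ) - j := by
      have := dvd_trans (Dvd.intro_left (6 : ℤ) rfl) (h1 0)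
      have h3 : (t : ℤ) ∣ (((w' 0).val : ℤ) - (w 0).val) * t := Dvd.intro_left _ rfl
      have h4 := dvd_sub this h3
      have e1 : (j' : ℤ) - j = ((w' 0).val * t + j') - ((w 0).val * t + j)
        - (((w' 0).val : ℤ) - (w 0).val) * t := by ring
      rw [e1]; exact h4
    obtain ⟨k, hk⟩ := h2
    have h5 : ∀ i, (6 : ℤ) ∣ ((w i).val : ℤ) - ((w' i).val + k) := by
      intro i
      apply (mul_dvd_mul_iff_right ht0).1
      rw [← dvd_neg]
      have e1 : -((((w i).val : ℤ) - ((w' i).val + k)) * t)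
        = ((w' i).val * t + j') - ((w i).val * t + j) := by linear_combination -hk
      rw [e1]; exact h1 i
    have h6' : w = w' + fun _ => (k : ZMod 6) := by
      ext1 i
      rw [(dwk_dvd_iff _ _).1 (h5 i)]
      simp
    have hww : w = w' := by
      obtain ⟨u, _, hu⟩ := hR2 w (hR1 w hx.1)
      rw [hu w ⟨hx.1, 0, by ext; simp⟩, hu w' ⟨hx'.1, _, h6'⟩]
    subst hww
    have h7 := h1 0
    have h8 : ((6 * t : ℕ) : ℤ) ∣ (j' : ℤ) - j := by
      push_cast
      convert h7 using 1; ring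
    have := (Nat.modEq_iff_dvd.2 h8)
    rw [Nat.ModEq, Nat.mod_eq_of_lt hx.2, Nat.mod_eq_of_lt hx'.2] at this
    rw [this]
  · intro η hη
    simp only [Finset.mem_filter, Finset.mem_univ, true_and] at hη
    choose e he using fun i => hω (η i)
    have hE : ∀ i, (6 * t : ℤ) ∣ (∑ k, (e k : ℤ)) - 6 * e i := by
      intro i
      have := hη i
      simp only [he] at this
      rw [Finset.prod_pow_eq_pow_sum, ← pow_mul, dwk_pow h6] at this
      push_cast at this
      rwa [mul_comm (e i : ℤ)] at this
    have h1 : ∀ i, ∃ m : ℤ, (e i : ℤ) - e 0 = t * m := by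
      intro i
      have := dvd_sub (hE 0) (hE i)
      apply (mul_dvd_mul_iff_left (by norm_num : (6 : ℤ) ≠ 0)).1
      convert this using 1; ring
    choose m hm using h1
    have hsum : ∑ i, (m i : ZMod 6) = 0 := by
      rw [← Int.cast_sum]
      refine (ZMod.intCast_zmod_eq_zero_iff_dvd _ 6).2 ?_
      apply (mul_dvd_mul_iff_right ht0).1
      have h2 : (∑ i, m i) * (t : ℤ) = (∑ k, (e k : ℤ)) - 6 * e 0 := by
        rw [mul_comm, Finset.mul_sum]
        simp only [← hm]
        rw [Finset.sum_sub_distrib]; simp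
      rw [h2]
      exact hE 0
    obtain ⟨w', ⟨hw', k, hk⟩, _⟩ := hR2 (fun i => (m i : ZMod 6)) hsum
    refine ⟨(w', (e 0 + k.val * t) % (6 * t)), ?_, ?_⟩
    · simp only [Finset.mem_product, Finset.mem_range]
      exact ⟨hw', Nat.mod_lt _ (by omega)⟩
    · ext1 i
      have hmod : ω ^ ((e 0 + k.val * t) % (6 * t)) = ω ^ (e 0 + k.val * t) := by
        rw [← h6, pow_mod_orderOf]
      simp only
      rw [pow_add, hmod, ← pow_add, he i, eq_comm, dwk_pow h6]
      have h3 : (6 : ℤ) ∣ ((w' i).val : ℤ) - (m i - k.val) := by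
        rw [dwk_dvd_iff]
        push_cast
        have := congrFun hk i
        simp only [Pi.add_apply] at this
        rw [this, ZMod.natCast_zmod_val]; ring
      have h4 := mul_dvd_mul_right h3 (t : ℤ)
      have e1 : (((w' i).val * t + (e 0 + k.val * t) : ℕ) : ℤ) - e i
        = (((w' i).val : ℤ) - (m i - k.val)) * t := by
        push_cast
        linear_combination -hm i
      rw [e1]; exact h4
  · rintro ⟨w, j⟩ _; rfl

end DworkBij

/-- Koblitz's formula specialized to the Dwork hypersurface of degree six.
The sum over `W/∼` is expressed as a sum over an arbitrary complete set `R` of representatives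
of the equivalence classes; in particular the inner sum of products of Gauss sums is
independent of the chosen representatives. -/
theorem koblitz_dwork_six (p e q t : ℕ) [Fact p.Prime] (F : Type) [Field F] [Fintype F]
    [Algebra (ZMod p) F]
    (he : 0 < e) (hq : q = Fintype.card F) (hqe : q = p ^ e) (hmod : q % 6 = 1)
    (ht : t = (q - 1) / 6)
    (ω : MulChar F ℂ) (hω : ∀ χ : MulChar F ℂ, ∃ j : ℕ, χ = ω ^ j)
    (lam : F) (hlam : lam ≠ 0) (hlam6 : lam ^ 6 ≠ 1)
    (R : Finset (Fin 6 → ZMod 6)) (hR1 : ∀ w ∈ R, ∑ i, w i = 0)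
    (hR2 : ∀ w : Fin 6 → ZMod 6, ∑ i, w i = 0 →
      ∃! w', w' ∈ R ∧ ∃ k : ZMod 6, w = w' + fun _ => k) :
    (dworkCount F 6 lam : ℂ) =
      (∑ w ∈ Finset.univ.filter (fun w : Fin 6 → ZMod 6 => ∑ i, w i = 0), NqW p F ω 6 w) +
        ∑ w ∈ R, SW p F ω 6 (fun _ => 1) w lam := by
  have : Fintype (MulChar F ℂ) := Fintype.ofFinite _
  obtain ⟨ψ, hψ, hg⟩ := dwk_gaussChar p F
  have hq1 : 1 < q := hq ▸ Fintype.one_lt_card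
  have hn : Fintype.card F - 1 = 6 * t := by omega
  have htF : (Fintype.card F - 1) / 6 = t := by omega
  have ht0 : 0 < t := by omega
  have hord : orderOf ω = 6 * t := by
    rw [← hn, ← dwk_nat_card, orderOf_eq_card_of_forall_mem_zpowers]
    intro χ
    obtain ⟨j, rfl⟩ := hω χ
    exact ⟨j, by simp⟩
  have hN : ∑ w ∈ Finset.univ.filter (fun w : Fin 6 → ZMod 6 => ∑ i, w i = 0), NqW p F ω 6 w
      = ((Fintype.card F : ℂ) ^ 5 - 1) / ((Fintype.card F : ℂ) - 1)
        + 1 / (Fintype.card F : ℂ) * ∑ η ∈ Finset.univ.filter (fun η : Fin 6 → MulChar F ℂ =>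
          (∀ i, η i ^ 6 = 1 ∧ η i ≠ 1) ∧ ∏ k, η k = 1), ∏ i, gaussSum (η i) ψ := by
    rw [← dwk_bij1 hord ht0 hω (fun η => ∏ i, gaussSum (η i) ψ),
      ← Finset.add_sum_erase _ _ (show (0 : Fin 6 → ZMod 6) ∈ Finset.univ.filter
        (fun w : Fin 6 → ZMod 6 => ∑ i, w i = 0) by simp)]
    have hN0 : NqW p F ω 6 (0 : Fin 6 → ZMod 6)
        = ((Fintype.card F : ℂ) ^ 5 - 1) / ((Fintype.card F : ℂ) - 1) := by simp [NqW]
    rw [hN0]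
    refine congrArg₂ _ rfl ?_
    · rw [← Finset.filter_filter, Finset.sum_filter (fun w : Fin 6 → ZMod 6 => ∀ i, w i ≠ 0),
        Finset.mul_sum,
        ← Finset.add_sum_erase (Finset.univ.filter (fun w : Fin 6 → ZMod 6 => ∑ i, w i = 0)) _
        (show (0 : Fin 6 → ZMod 6) ∈ Finset.univ.filter
        (fun w : Fin 6 → ZMod 6 => ∑ i, w i = 0) by simp)]
      rw [if_neg (by simp), mul_zero, zero_add]
      refine Finset.sum_congr rfl fun w hw => ?_
      have hw0 : ¬ ∀ i, w i = 0 := fun h => Finset.ne_of_mem_erase hw (funext h)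
      unfold NqW
      rw [if_neg hw0, htF]
      simp only [hg]
      split_ifs <;> simp
  have hS : ∑ w ∈ R, SW p F ω 6 (fun _ => 1) w lam
      = ((Fintype.card F : ℂ) - 1)⁻¹ * (dwkN (((6 : ℕ) : F) * lam) - dwkN (0 : F)) := by
    rw [dwk_diff hψ, ← dwk_bij2 hord ht0 hω R hR1 hR2 (fun η => (∏ i, gaussSum (η i) ψ) /
      gaussSum (∏ i, η i) ψ * (∏ i, η i) (((6 : ℕ) : F) * lam)), Finset.sum_product,
      Finset.mul_sum]
    refine Finset.sum_congr rfl fun w hw => ?_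
    unfold SW
    rw [htF, hn]
    refine congrArg₂ _ rfl (Finset.sum_congr rfl fun j _ => ?_)
    simp only [hg, one_mul]
    rw [dwk_prod_pow hord w (hR1 w hw)]
  rw [hN, hS]
  have hP := dwk_proj lam
  have hF := dwk_fermat hψ
  have h1 := dwk_card_sub_ne (F := F)
  have h2 := dwk_card_ne (F := F)
  rw [eq_div_of_mul_eq h1 hP]
  field_simp
  linear_combination hF
end

section
/- Let q = p^e be a power of a prime with q ≡ 1 (mod 6), t = (q-1)/6, ω₆ = ω^t, ω₃ = ω^{2t}, ω₂ = ω^{3t}, and let λ ∈ 𝔽_q with λ ≠ 0 and λ⁶ ≠ 1. For the equivalence class of w = (0,0,0,0,0,0): Σ_{w'∈[0,0,0,0,0,0]} N_q(0,w') + S_{[0,0,0,0,0,0]} = (q⁵-1)/(q-1) + q⁴·₅F₄(ω₆,ω₃,ω₂,ω̄₃,ω̄₆; ε,ε,ε,ε | 1/λ⁶)_q. -/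
open scoped Classical

section HDaux
set_option linter.unusedSectionVars false
variable {F : Type} [Field F] [Fintype F]

lemma hd_sumchar [Fintype (MulChar F ℂ)] (a : F) :
    ∑ ψ : MulChar F ℂ, ψ a = if a = 1 then (Fintype.card F : ℂ) - 1 else 0 := by
  split_ifs with h
  · subst h
    simp only [MulChar.map_one, Finset.sum_const, nsmul_eq_mul, mul_one, Finset.card_univ]
    rw [← Nat.card_eq_fintype_card, MulChar.card_eq_card_units_of_hasEnoughRootsOfUnity,
      Nat.card_eq_fintype_card, Fintype.card_eq_card_units_add_one (α := F)]
    push_cast; ring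
  · obtain ⟨χ, hχ⟩ := MulChar.exists_apply_ne_one_of_hasEnoughRootsOfUnity F ℂ h
    have h1 : χ a * ∑ ψ : MulChar F ℂ, ψ a = ∑ ψ : MulChar F ℂ, ψ a := by
      rw [Finset.mul_sum, ← Equiv.sum_comp (Equiv.mulLeft χ) (fun ψ : MulChar F ℂ => ψ a)]
      simp
    have h2 : (χ a - 1) * ∑ ψ : MulChar F ℂ, ψ a = 0 := by rw [sub_mul, h1]; ring
    rcases mul_eq_zero.mp h2 with h3 | h3
    · exact absurd (sub_eq_zero.mp h3) hχ
    · exact h3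

lemma hd_card_mulchar [Fintype (MulChar F ℂ)] :
    (Fintype.card (MulChar F ℂ) : ℝ) = (Fintype.card F : ℝ) - 1 := by
  rw [← Nat.card_eq_fintype_card, MulChar.card_eq_card_units_of_hasEnoughRootsOfUnity,
      Nat.card_eq_fintype_card, Fintype.card_eq_card_units_add_one (α := F)]
  push_cast; ring

variable {θ : AddChar F ℂ}

lemma hd_ne_one (hθ : θ.IsPrimitive) : θ ≠ 1 := by
  intro h
  have := hθ (one_ne_zero (α := F))
  rw [AddChar.mulShift_one] at this
  exact this h

lemma hd_g_one (hθ : θ.IsPrimitive) : gaussSum (1 : MulChar F ℂ) θ = -1 := gaussSum_one_left (hd_ne_one hθ)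

lemma hd_g_star (hθ : θ.IsPrimitive) {χ : MulChar F ℂ} (hχ : χ ≠ 1) :
    gaussSum χ θ * star (gaussSum χ θ) = Fintype.card F := by
  rw [star_gaussSum_eq, gaussSum_mul_gaussSum_eq_card hχ hθ]

lemma hd_g_norm (hθ : θ.IsPrimitive) (χ : MulChar F ℂ) :
    ‖gaussSum χ θ‖ ^ 2 = if χ = 1 then 1 else (Fintype.card F : ℝ) := by
  split_ifs with h
  · rw [h, hd_g_one hθ]; simp
  · have := hd_g_star hθ h
    have h2 := Complex.mul_conj' (gaussSum χ θ)
    change gaussSum χ θ * star (gaussSum χ θ) = _ at h2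
    rw [this] at h2
    exact_mod_cast h2.symm

lemma hd_g_inv (hθ : θ.IsPrimitive) {χ : MulChar F ℂ} (hχ : χ ≠ 1) :
    gaussSum χ θ * gaussSum χ⁻¹ θ = χ (-1) * Fintype.card F := by
  rw [← gaussSum_mul_gaussSum_eq_card hχ hθ, ← mul_gaussSum_inv_eq_gaussSum χ⁻¹ θ]
  have : (χ⁻¹ : MulChar F ℂ) (-1) = χ (-1) := by
    rw [MulChar.inv_apply']; congr 1; norm_num
  rw [this]; ring

lemma hd_g_ne (hθ : θ.IsPrimitive) (χ : MulChar F ℂ) : gaussSum χ θ ≠ 0 := by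
  intro h
  have := hd_g_norm hθ χ
  rw [h] at this
  split_ifs at this
  · simp at this
  · have h3 : (0:ℝ) < Fintype.card F := by exact_mod_cast Fintype.card_pos
    norm_num at this
    linarith

lemma hd_shift (hθ : θ.IsPrimitive) {χ : MulChar F ℂ} (hχ : χ ≠ 1) (c : F) :
    ∑ u, χ u * θ (u * c) = χ⁻¹ c * gaussSum χ θ := by
  by_cases hc : c = 0
  · subst hc
    simp [MulChar.sum_eq_zero_of_ne_one hχ, MulChar.map_zero]
  · have := gaussSum_mulShift_eq χ θ (Units.mk0 c hc)
    simp only [gaussSum, AddChar.mulShift_apply, Units.val_mk0] at this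
    rw [gaussSum, ← this]
    exact Finset.sum_congr rfl fun u _ => by rw [mul_comm c]

lemma hd_shift_one (hθ : θ.IsPrimitive) (c : F) :
    ∑ u, (1 : MulChar F ℂ) u * θ (u * c) = (if c = 0 then (Fintype.card F : ℂ) else 0) - 1 := by
  have h := AddChar.sum_mulShift c hθ
  have h0 : ∀ u : F, (1 : MulChar F ℂ) u * θ (u * c) = θ (u * c) - if u = 0 then 1 else 0 := by
    intro u
    by_cases hu : u = 0
    · subst hu; simp [MulChar.map_zero]
    · rw [MulChar.one_apply (isUnit_iff_ne_zero.mpr hu)]; simp [hu]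
  simp_rw [h0, Finset.sum_sub_distrib, h]
  simp

lemma hd_g_scale (χ : MulChar F ℂ) {u : F} (hu : u ≠ 0) :
    star (χ u) * gaussSum χ θ = ∑ x, χ x * θ (u * x) := by
  have := gaussSum_mulShift χ θ (Units.mk0 u hu)
  rw [← this]
  simp only [gaussSum, AddChar.mulShift_apply, Units.val_mk0]
  rw [← mul_assoc, MulChar.star_apply', ← MulChar.mul_apply, inv_mul_cancel,
    MulChar.one_apply (isUnit_iff_ne_zero.mpr hu), one_mul]

lemma hd_star_theta (x : F) : star (θ x) = θ (-x) := by
  have : 0 < ringChar F := Nat.pos_of_ne_zero (CharP.char_ne_zero_of_finite F _)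
  have := AddChar.starComp_apply this (φ := θ) x
  rw [AddChar.inv_apply] at this
  exact this

lemma hd_cauchy {ι : Type*} [Fintype ι] (G H : ι → ℂ) (C : ℝ)
    (hG : ∑ i, ‖G i‖ ^ 2 ≤ C) (hH : ∑ i, ‖H i‖ ^ 2 ≤ C)
    (hGH : C ≤ (∑ i, G i * star (H i)).re) : ∀ i, G i = H i := by
  have key : ∑ i, ‖G i - H i‖ ^ 2 ≤ 0 := by
    have : ∀ i, ‖G i - H i‖ ^ 2 = ‖G i‖ ^ 2 + ‖H i‖ ^ 2 - 2 * (G i * star (H i)).re := by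
      intro i
      rw [← Complex.normSq_eq_norm_sq, ← Complex.normSq_eq_norm_sq, ← Complex.normSq_eq_norm_sq,
        Complex.normSq_sub]
      rfl
    simp_rw [this, Finset.sum_sub_distrib, Finset.sum_add_distrib, ← Finset.mul_sum]
    rw [Complex.re_sum] at hGH
    linarith
  have h0 := (Finset.sum_eq_zero_iff_of_nonneg (fun i _ => sq_nonneg ‖G i - H i‖)).mp
    (le_antisymm key (Finset.sum_nonneg fun i _ => sq_nonneg _))
  intro i
  have := h0 i (Finset.mem_univ i)
  exact sub_eq_zero.mp (norm_eq_zero.mp (pow_eq_zero_iff two_ne_zero |>.mp this))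

lemma hd_sum_inv (h : F → ℂ) (y : F) :
    ∑ x, (if x * y = 1 then h x else 0) = if y = 0 then 0 else h y⁻¹ := by
  split_ifs with hy
  · subst hy; simp
  · have : ∀ x, x * y = 1 ↔ x = y⁻¹ := fun x => ⟨fun h => eq_inv_of_mul_eq_one_left h, fun h => by rw [h, inv_mul_cancel₀ hy]⟩
    simp [this]

lemma hd_scale_sq (χ : MulChar F ℂ) (n : ℕ) (c : F) (hc : c ≠ 0) (hn : n ≠ 0) :
    χ c ^ n * ∑ u, χ u ^ n * θ (c * u) = gaussSum (χ ^ n) θ := by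
  have := gaussSum_mulShift (χ ^ n) θ (Units.mk0 c hc)
  rw [← this]
  simp only [gaussSum, AddChar.mulShift_apply, Units.val_mk0, MulChar.pow_apply' χ hn]

end HDaux

section HDdup
set_option linter.unusedSectionVars false
variable {F : Type} [Field F] [Fintype F] {θ : AddChar F ℂ}

lemma hd_dup_sum [Fintype (MulChar F ℂ)] (hθ : θ.IsPrimitive) {φ : MulChar F ℂ} (hφ : φ ≠ 1)
    (hφ2 : φ ^ 2 = 1) :
    ∑ ψ : MulChar F ℂ, (gaussSum ψ θ * gaussSum (ψ * φ) θ) *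
      star (gaussSum φ θ * ∑ u, ψ u ^ 2 * θ (2 * u)) =
    (Fintype.card F : ℂ) * ((Fintype.card F : ℂ) - 1) * ((Fintype.card F : ℂ) - 2) := by
  have hinv : φ⁻¹ = φ := by
    rw [inv_eq_iff_mul_eq_one, ← sq, hφ2]
  have step1 : ∀ ψ : MulChar F ℂ, (gaussSum ψ θ * gaussSum (ψ * φ) θ) *
      star (gaussSum φ θ * ∑ u, ψ u ^ 2 * θ (2 * u)) =
      star (gaussSum φ θ) * ∑ u, ∑ y, ∑ x, φ u * θ (-(2 * u)) * (φ y * θ (u * (x + y))) * ψ (x * y) := by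
    intro ψ
    rw [star_mul', star_sum, mul_left_comm, Finset.mul_sum]
    congr 1
    refine Finset.sum_congr rfl fun u _ => ?_
    by_cases hu : u = 0
    · subst hu
      simp [MulChar.map_zero]
    · have h1 := hd_g_scale (θ := θ) ψ hu
      have h2 := hd_g_scale (θ := θ) (ψ * φ) hu
      have h3 : star (φ u) * φ u = 1 := by
        rw [MulChar.star_apply', ← MulChar.mul_apply, inv_mul_cancel,
          MulChar.one_apply (isUnit_iff_ne_zero.mpr hu)]
      have : gaussSum ψ θ * gaussSum (ψ * φ) θ * star (ψ u ^ 2 * θ (2 * u)) =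
          φ u * θ (-(2*u)) * ((star ((ψ * φ) u) * gaussSum (ψ * φ) θ) * (star (ψ u) * gaussSum ψ θ)) := by
        rw [star_mul', star_pow, hd_star_theta, MulChar.mul_apply, star_mul']
        linear_combination (- gaussSum ψ θ * gaussSum (ψ * φ) θ * star (ψ u) ^ 2 * θ (-(2 * u))) * h3
      rw [this, h1, h2, Finset.sum_mul_sum, Finset.mul_sum]
      refine Finset.sum_congr rfl fun y _ => ?_
      rw [Finset.mul_sum]
      refine Finset.sum_congr rfl fun x _ => ?_
      rw [mul_add, AddChar.map_add_eq_mul, map_mul ψ, MulChar.mul_apply]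
      ring
  simp_rw [step1]
  rw [← Finset.mul_sum, Finset.sum_comm]
  have step2 : ∀ u : F, ∑ ψ : MulChar F ℂ, ∑ y, ∑ x,
      φ u * θ (-(2 * u)) * (φ y * θ (u * (x + y))) * ψ (x * y) =
      ∑ y, φ y * (((Fintype.card F : ℂ) - 1) * (φ u * θ (u * (y⁻¹ + y - 2)))) := by
    intro u
    rw [Finset.sum_comm]
    refine Finset.sum_congr rfl fun y _ => ?_
    rw [Finset.sum_comm]
    simp_rw [← Finset.mul_sum, hd_sumchar, mul_ite, mul_zero]
    rw [hd_sum_inv (fun x => φ u * θ (-(2 * u)) * (φ y * θ (u * (x + y))) * ((Fintype.card F : ℂ) - 1))]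
    split_ifs with hy
    · subst hy; simp [MulChar.map_zero]
    · have : u * (y⁻¹ + y - 2) = -(2 * u) + u * (y⁻¹ + y) := by ring
      rw [this, AddChar.map_add_eq_mul]
      ring
  simp_rw [step2]
  rw [Finset.sum_comm]
  simp_rw [← Finset.mul_sum, hd_shift hθ hφ, hinv]
  have step3 : ∀ y : F, φ y * (((Fintype.card F : ℂ) - 1) * (φ (y⁻¹ + y - 2) * gaussSum φ θ)) =
      ((Fintype.card F : ℂ) - 1) * gaussSum φ θ *
       ((1 - if y = 0 then 1 else 0) - if y = 1 then 1 else 0) := by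
    intro y
    by_cases h0 : y = 0
    · subst h0; simp [MulChar.map_zero]
    by_cases h1 : y = 1
    · subst h1
      have : (1 : F)⁻¹ + 1 - 2 = 0 := by norm_num
      rw [this]; simp [MulChar.map_zero]
    have h : φ y * φ (y⁻¹ + y - 2) = 1 := by
      rw [← map_mul]
      have : y * (y⁻¹ + y - 2) = (y - 1) ^ 2 := by field_simp; ring
      rw [this, map_pow, ← MulChar.pow_apply' φ two_ne_zero, hφ2,
        MulChar.one_apply (isUnit_iff_ne_zero.mpr (sub_ne_zero.mpr h1))]
    simp only [h0, h1, if_false, sub_zero, mul_one]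
    linear_combination (((Fintype.card F : ℂ) - 1) * gaussSum φ θ) * h
  simp_rw [step3, ← Finset.mul_sum, Finset.sum_sub_distrib]
  simp only [Finset.sum_const, Finset.card_univ, nsmul_eq_mul, mul_one, Finset.sum_ite_eq',
    Finset.mem_univ, if_true]
  linear_combination (((Fintype.card F : ℂ) - 1) * ((Fintype.card F : ℂ) - 2)) * hd_g_star hθ hφ

lemma hd_norm_mul (a b : ℂ) : ‖a * b‖ ^ 2 = ‖a‖ ^ 2 * ‖b‖ ^ 2 := by rw [norm_mul, mul_pow]

lemma hd_norm_char {χ : MulChar F ℂ} {c : F} (hc : c ≠ 0) : ‖χ c‖ = 1 := by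
  have h : χ c * star (χ c) = 1 := by
    rw [MulChar.star_apply', ← MulChar.mul_apply, mul_inv_cancel,
          MulChar.one_apply (isUnit_iff_ne_zero.mpr hc)]
  have h2 := Complex.mul_conj' (χ c)
  change χ c * star (χ c) = _ at h2
  rw [h] at h2
  have h3 : ‖χ c‖ ^ 2 = 1 := by exact_mod_cast h2.symm
  nlinarith [norm_nonneg (χ c)]

lemma hd_norm_scaled (χ : MulChar F ℂ) (n : ℕ) (c : F) (hc : c ≠ 0) (hn : n ≠ 0) :
    ‖∑ u, χ u ^ n * θ (c * u)‖ = ‖gaussSum (χ ^ n) θ‖ := by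
  rw [← hd_scale_sq χ n c hc hn, norm_mul, norm_pow, hd_norm_char hc, one_pow, one_mul]

lemma hd_dup (hθ : θ.IsPrimitive) {φ : MulChar F ℂ} (hφ : φ ≠ 1)
    (hφ2 : φ ^ 2 = 1) (h2 : (2 : F) ≠ 0) (ψ : MulChar F ℂ) :
    ψ 2 ^ 2 * (gaussSum ψ θ * gaussSum (ψ * φ) θ) = gaussSum φ θ * gaussSum (ψ ^ 2) θ := by
  have : Fintype (MulChar F ℂ) := Fintype.ofFinite _
  have hq : (1 : ℝ) < Fintype.card F := by exact_mod_cast Fintype.one_lt_card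
  have hinv : φ⁻¹ = φ := by
    rw [inv_eq_iff_mul_eq_one, ← sq, hφ2]
  have main := hd_cauchy (fun ψ : MulChar F ℂ => gaussSum ψ θ * gaussSum (ψ * φ) θ)
    (fun ψ : MulChar F ℂ => gaussSum φ θ * ∑ u, ψ u ^ 2 * θ (2 * u))
    ((Fintype.card F : ℝ) * ((Fintype.card F : ℝ) - 1) * ((Fintype.card F : ℝ) - 2)) ?_ ?_ ?_ ψ
  · rw [main, ← hd_scale_sq ψ 2 2 h2 two_ne_zero]
    ring
  · have : ∀ ψ : MulChar F ℂ, ‖gaussSum ψ θ * gaussSum (ψ * φ) θ‖ ^ 2 =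
        (Fintype.card F : ℝ) ^ 2 - ((Fintype.card F : ℝ) ^ 2 - Fintype.card F) *
          ((if ψ = 1 then 1 else 0) + (if ψ = φ then 1 else 0)) := by
      intro ψ
      rw [hd_norm_mul, hd_g_norm hθ, hd_g_norm hθ]
      have e : ψ * φ = 1 ↔ ψ = φ := by rw [mul_eq_one_iff_eq_inv, hinv]
      rw [if_congr e rfl rfl]
      by_cases h1 : ψ = 1
      · subst h1; simp [hφ.symm]
      · by_cases h3 : ψ = φ
        · simp [h3, hφ]
        · simp [h1, h3]; ring
    simp_rw [this, Finset.sum_sub_distrib, ← Finset.mul_sum, Finset.sum_add_distrib]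
    simp only [Finset.sum_const, Finset.card_univ, nsmul_eq_mul, Finset.sum_ite_eq',
      Finset.mem_univ, if_true, hd_card_mulchar]
    apply le_of_eq; ring
  · have : ∀ ψ : MulChar F ℂ, ‖gaussSum φ θ * ∑ u, ψ u ^ 2 * θ (2 * u)‖ ^ 2 ≤
        (Fintype.card F : ℝ) ^ 2 - ((Fintype.card F : ℝ) ^ 2 - Fintype.card F) *
          ((if ψ = 1 then 1 else 0) + (if ψ = φ then 1 else 0)) := by
      intro ψ
      rw [hd_norm_mul, hd_norm_scaled ψ 2 2 h2 two_ne_zero, hd_g_norm hθ, hd_g_norm hθ, if_neg hφ]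
      by_cases h1 : ψ = 1
      · subst h1; simp [hφ.symm]
      · by_cases h3 : ψ = φ
        · simp [h3, hφ, hφ2]
        · simp only [h1, h3, if_false]
          split_ifs <;> nlinarith
    refine (Finset.sum_le_sum fun ψ _ => this ψ).trans ?_
    simp_rw [Finset.sum_sub_distrib, ← Finset.mul_sum, Finset.sum_add_distrib]
    simp only [Finset.sum_const, Finset.card_univ, nsmul_eq_mul, Finset.sum_ite_eq',
      Finset.mem_univ, if_true, hd_card_mulchar]
    apply le_of_eq; ring
  · have := hd_dup_sum hθ hφ hφ2
    rw [this]
    have e : (Fintype.card F : ℂ) * ((Fintype.card F : ℂ) - 1) * ((Fintype.card F : ℂ) - 2) =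
      (((Fintype.card F : ℝ) * ((Fintype.card F : ℝ) - 1) * ((Fintype.card F : ℝ) - 2) : ℝ) : ℂ) := by
      push_cast; ring
    rw [e, Complex.ofReal_re]

end HDdup

section HDtrip
set_option linter.unusedSectionVars false
variable {F : Type} [Field F] [Fintype F] {θ : AddChar F ℂ}

/-- The points of the nodal cubic `xyz = 1, x + y + z = 3`. -/
noncomputable def hdT (F : Type) [Field F] [Fintype F] : Finset (F × F) :=
  Finset.univ.filter fun v => v.1 ≠ 0 ∧ v.2 ≠ 0 ∧ (v.1 * v.2)⁻¹ + v.1 + v.2 - 3 = 0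

lemma hdT_char {χ : MulChar F ℂ} (hχ3 : χ ^ 3 = 1) {v : F × F} (hv : v ∈ hdT F) :
    χ v.1 * χ⁻¹ v.2 = 1 := by
  obtain ⟨y, z⟩ := v
  simp only [hdT, Finset.mem_filter, Finset.mem_univ, true_and] at hv
  obtain ⟨hy, hz, h⟩ := hv
  have hcube : ∀ a : F, a ≠ 0 → χ a ^ 3 = 1 := by
    intro a ha
    rw [← MulChar.pow_apply' χ three_ne_zero, hχ3, MulChar.one_apply (isUnit_iff_ne_zero.mpr ha)]
  have hz1 : χ z * χ⁻¹ z = 1 := by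
    rw [← MulChar.mul_apply, mul_inv_cancel, MulChar.one_apply (isUnit_iff_ne_zero.mpr hz)]
  have e : 1 + y ^ 2 * z + y * z ^ 2 - 3 * (y * z) = 0 := by
    field_simp at h
    linear_combination h
  have main : χ y = χ z := by
    by_cases h1 : z = 1
    · subst h1
      have : (y - 1) ^ 2 = 0 := by linear_combination e
      have : y = 1 := sub_eq_zero.mp (pow_eq_zero_iff two_ne_zero |>.mp this)
      rw [this]
    · have key : y * (1 - z) ^ 3 = z * (1 - y) ^ 3 := by
        linear_combination (y - z) * e
      have hz' : (1 - z) ≠ 0 := sub_ne_zero.mpr (Ne.symm h1)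
      have hy' : (1 - y) ≠ 0 := by
        intro h0
        rw [h0] at key
        simp [hy, hz'] at key
      have := congrArg χ key
      rw [map_mul, map_mul, map_pow, map_pow, hcube _ hz', hcube _ hy'] at this
      simpa using this
  simp only
  rw [main, hz1]

lemma hdT_card : Fintype.card F ≤ (hdT F).card + 3 := by
  let S : Finset F := Finset.univ.filter fun s => s ≠ 0 ∧ s ≠ -1 ∧ s ^ 2 + s + 1 ≠ 0
  have hS : Fintype.card F ≤ S.card + 4 := by
    have h1 : S.card + Sᶜ.card = Fintype.card F := Finset.card_add_card_compl S
    have h2 : Sᶜ.card ≤ 4 := by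
      by_cases hr : ∃ r : F, r ^ 2 + r + 1 = 0
      · obtain ⟨r, hr⟩ := hr
        have : Sᶜ ⊆ ({0, -1, r, -1 - r} : Finset F) := by
          intro s hs
          simp only [S, Finset.mem_compl, Finset.mem_filter, Finset.mem_univ, true_and] at hs
          simp only [Finset.mem_insert, Finset.mem_singleton]
          by_contra hcon
          push Not at hcon
          obtain ⟨c1, c2, c3, c4⟩ := hcon
          refine hs ⟨c1, c2, fun h => ?_⟩
          have : (s - r) * (s - (-1 - r)) = 0 := by linear_combination h - hr
          rcases mul_eq_zero.mp this with h' | h'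
          · exact c3 (sub_eq_zero.mp h')
          · exact c4 (sub_eq_zero.mp h')
        exact (Finset.card_le_card this).trans Finset.card_le_four
      · have : Sᶜ ⊆ ({0, -1} : Finset F) := by
          intro s hs
          simp only [S, Finset.mem_compl, Finset.mem_filter, Finset.mem_univ, true_and] at hs
          simp only [Finset.mem_insert, Finset.mem_singleton]
          by_contra hcon
          push Not at hcon
          obtain ⟨c1, c2⟩ := hcon
          exact hs ⟨c1, c2, fun h => hr ⟨s, h⟩⟩
        exact (Finset.card_le_card this).trans (Finset.card_le_two.trans (by norm_num))
    omega
  have h11 : ((1 : F), (1 : F)) ∈ hdT F := by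
    simp only [hdT, Finset.mem_filter, Finset.mem_univ, true_and]
    refine ⟨one_ne_zero, one_ne_zero, by norm_num⟩
  have hle : S.card ≤ ((hdT F).erase (1, 1)).card := by
    refine Finset.card_le_card_of_injOn (fun s => (-(s ^ 2) / (1 + s), -1 / (s * (1 + s)))) ?_ ?_
    · intro s hs
      simp only [S, Finset.coe_filter, Finset.mem_univ, true_and, Set.mem_ofPred_eq] at hs
      obtain ⟨h0, h1, h2⟩ := hs
      have h1' : 1 + s ≠ 0 := fun h => h1 (by linear_combination h)
      simp only [hdT, Finset.coe_erase, Set.mem_sdiff, Finset.coe_filter, Finset.mem_univ, true_and,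
        Set.mem_ofPred_eq, Set.mem_singleton_iff, Prod.mk.injEq]
      refine ⟨⟨?_, ?_, ?_⟩, ?_⟩
      · exact div_ne_zero (neg_ne_zero.mpr (pow_ne_zero 2 h0)) h1'
      · exact div_ne_zero (neg_ne_zero.mpr one_ne_zero) (mul_ne_zero h0 h1')
      · field_simp
        ring
      · rintro ⟨_, h⟩
        rw [div_eq_one_iff_eq (mul_ne_zero h0 h1')] at h
        exact h2 (by linear_combination -h)
    · intro s hs s' hs' h
      simp only [S, Finset.coe_filter, Finset.mem_univ, true_and, Set.mem_ofPred_eq] at hs hs'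
      obtain ⟨h0, h1, h2⟩ := hs
      obtain ⟨h0', h1', h2'⟩ := hs'
      have k1 : 1 + s ≠ 0 := fun h => h1 (by linear_combination h)
      have k1' : 1 + s' ≠ 0 := fun h => h1' (by linear_combination h)
      have fact : ∀ a : F, a ≠ 0 → 1 + a ≠ 0 → a ^ 2 + a + 1 ≠ 0 →
          a = (1 - -(a ^ 2) / (1 + a)) / (1 - -1 / (a * (1 + a))) := by
        intro a ha ha1 ha2
        have e1 : 1 - -(a ^ 2) / (1 + a) = (a ^ 2 + a + 1) / (1 + a) := by field_simp; ring
        have e2 : 1 - -1 / (a * (1 + a)) = (a ^ 2 + a + 1) / (a * (1 + a)) := by field_simp; ring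
        rw [e1, e2]
        generalize a ^ 2 + a + 1 = k at ha2
        field_simp
      simp only [Prod.mk.injEq] at h
      rw [fact s h0 k1 h2, fact s' h0' k1' h2', h.1, h.2]
  rw [Finset.card_erase_of_mem h11] at hle
  have : 0 < (hdT F).card := Finset.card_pos.mpr ⟨_, h11⟩
  omega

lemma hd_trip_sum [Fintype (MulChar F ℂ)] (hθ : θ.IsPrimitive) {χ : MulChar F ℂ} (hχ : χ ≠ 1)
    (hχ3 : χ ^ 3 = 1) :
    ∑ ψ : MulChar F ℂ, (gaussSum ψ θ * gaussSum (ψ * χ) θ * gaussSum (ψ * χ⁻¹) θ) *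
      star ((Fintype.card F : ℂ) * ∑ u, ψ u ^ 3 * θ (3 * u)) =
    (Fintype.card F : ℂ) * ((Fintype.card F : ℂ) - 1) * ((Fintype.card F : ℂ) * (hdT F).card) := by
  have step1 : ∀ ψ : MulChar F ℂ, (gaussSum ψ θ * gaussSum (ψ * χ) θ * gaussSum (ψ * χ⁻¹) θ) *
      star ((Fintype.card F : ℂ) * ∑ u, ψ u ^ 3 * θ (3 * u)) =
      (Fintype.card F : ℂ) * ∑ u, ∑ y, ∑ z, ∑ x, (1 : MulChar F ℂ) u * θ (-(3 * u)) *
        (χ y * χ⁻¹ z * θ (u * (x + y + z))) * ψ (x * (y * z)) := by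
    intro ψ
    rw [star_mul', star_sum, mul_left_comm, Finset.mul_sum, star_natCast]
    congr 1
    refine Finset.sum_congr rfl fun u _ => ?_
    by_cases hu : u = 0
    · subst hu
      simp [MulChar.map_zero]
    · have h1 := hd_g_scale (θ := θ) ψ hu
      have h2 := hd_g_scale (θ := θ) (ψ * χ) hu
      have h4 := hd_g_scale (θ := θ) (ψ * χ⁻¹) hu
      have h3 : star (χ u) * star (χ⁻¹ u) = 1 := by
        rw [← star_mul', ← MulChar.mul_apply, mul_inv_cancel,
          MulChar.one_apply (isUnit_iff_ne_zero.mpr hu), star_one]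
      have h5 : (1 : MulChar F ℂ) u = 1 := MulChar.one_apply (isUnit_iff_ne_zero.mpr hu)
      have : gaussSum ψ θ * gaussSum (ψ * χ) θ * gaussSum (ψ * χ⁻¹) θ * star (ψ u ^ 3 * θ (3 * u)) =
          θ (-(3*u)) * ((star ((ψ * χ) u) * gaussSum (ψ * χ) θ) *
          ((star ((ψ * χ⁻¹) u) * gaussSum (ψ * χ⁻¹) θ) * (star (ψ u) * gaussSum ψ θ))) := by
        rw [star_mul', star_pow, hd_star_theta, MulChar.mul_apply, star_mul', MulChar.mul_apply, star_mul']
        linear_combination (- gaussSum ψ θ * gaussSum (ψ * χ) θ * gaussSum (ψ * χ⁻¹) θ *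
          star (ψ u) ^ 3 * θ (-(3 * u))) * h3
      rw [this, h1, h2, h4, Finset.sum_mul_sum, Finset.sum_mul_sum, Finset.mul_sum]
      refine Finset.sum_congr rfl fun y _ => ?_
      rw [Finset.mul_sum]
      refine Finset.sum_congr rfl fun z _ => ?_
      rw [Finset.mul_sum, Finset.mul_sum]
      refine Finset.sum_congr rfl fun x _ => ?_
      rw [mul_add, mul_add, AddChar.map_add_eq_mul, AddChar.map_add_eq_mul, map_mul ψ, map_mul ψ,
        MulChar.mul_apply, MulChar.mul_apply, h5]
      ring
  simp_rw [step1]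
  rw [← Finset.mul_sum, Finset.sum_comm]
  have step2 : ∀ u : F, ∑ ψ : MulChar F ℂ, ∑ y, ∑ z, ∑ x, (1 : MulChar F ℂ) u * θ (-(3 * u)) *
        (χ y * χ⁻¹ z * θ (u * (x + y + z))) * ψ (x * (y * z)) =
      ∑ y, ∑ z, χ y * χ⁻¹ z * (((Fintype.card F : ℂ) - 1) *
        ((1 : MulChar F ℂ) u * θ (u * ((y * z)⁻¹ + y + z - 3)))) := by
    intro u
    rw [Finset.sum_comm]
    refine Finset.sum_congr rfl fun y _ => ?_
    rw [Finset.sum_comm]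
    refine Finset.sum_congr rfl fun z _ => ?_
    rw [Finset.sum_comm]
    simp_rw [← Finset.mul_sum, hd_sumchar, mul_ite, mul_zero]
    rw [hd_sum_inv (fun x => (1 : MulChar F ℂ) u * θ (-(3 * u)) *
        (χ y * χ⁻¹ z * θ (u * (x + y + z))) * ((Fintype.card F : ℂ) - 1))]
    split_ifs with hy
    · have : χ y * χ⁻¹ z = 0 := by
        rcases mul_eq_zero.mp hy with h | h <;> simp [h, MulChar.map_zero]
      rw [this, zero_mul]
    · have : u * ((y * z)⁻¹ + y + z - 3) = -(3 * u) + u * ((y * z)⁻¹ + y + z) := by ring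
      rw [this, AddChar.map_add_eq_mul]
      ring
  simp_rw [step2]
  rw [Finset.sum_comm]
  have step3 : ∀ y : F, ∑ u, ∑ z, χ y * χ⁻¹ z * (((Fintype.card F : ℂ) - 1) *
        ((1 : MulChar F ℂ) u * θ (u * ((y * z)⁻¹ + y + z - 3)))) =
      ∑ z, (((Fintype.card F : ℂ) - 1) * ((Fintype.card F : ℂ) *
        (if (y, z) ∈ hdT F then 1 else 0)) - ((Fintype.card F : ℂ) - 1) * (χ y * χ⁻¹ z)) := by
    intro y
    rw [Finset.sum_comm]
    refine Finset.sum_congr rfl fun z _ => ?_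
    simp_rw [← Finset.mul_sum, hd_shift_one hθ]
    by_cases hy : y = 0
    · simp [hy, hdT, MulChar.map_zero]
    by_cases hz : z = 0
    · simp [hz, hdT, MulChar.map_zero]
    by_cases hc : (y * z)⁻¹ + y + z - 3 = 0
    · have hm : (y, z) ∈ hdT F := by
        simp only [hdT, Finset.mem_filter, Finset.mem_univ, true_and]
        exact ⟨hy, hz, hc⟩
      have := hdT_char hχ3 hm
      simp only at this
      rw [if_pos hc, if_pos hm, this]; ring
    · have hm : (y, z) ∉ hdT F := by
        simp only [hdT, Finset.mem_filter, Finset.mem_univ, true_and]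
        exact fun h => hc h.2.2
      rw [if_neg hc, if_neg hm]; ring
  simp_rw [step3, Finset.sum_sub_distrib, ← Finset.mul_sum,
    MulChar.sum_eq_zero_of_ne_one (inv_ne_one.mpr hχ)]
  rw [← Fintype.sum_prod_type (f := fun v : F × F => if v ∈ hdT F then (1 : ℂ) else 0)]
  simp
  ring

lemma hd_trip (hθ : θ.IsPrimitive) {χ : MulChar F ℂ} (hχ : χ ≠ 1)
    (hχ3 : χ ^ 3 = 1) (h3 : (3 : F) ≠ 0) (ψ : MulChar F ℂ) :
    ψ 3 ^ 3 * (gaussSum ψ θ * gaussSum (ψ * χ) θ * gaussSum (ψ * χ⁻¹) θ) =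
      Fintype.card F * gaussSum (ψ ^ 3) θ := by
  have : Fintype (MulChar F ℂ) := Fintype.ofFinite _
  have hq : (1 : ℝ) < Fintype.card F := by exact_mod_cast Fintype.one_lt_card
  have hne : χ⁻¹ ≠ χ := by
    intro h
    rw [inv_eq_iff_mul_eq_one] at h
    apply hχ
    calc χ = χ ^ 3 * (χ * χ)⁻¹ := by rw [pow_three]; group
      _ = 1 := by rw [h, hχ3]; simp
  have hi1 : χ⁻¹ ≠ 1 := inv_ne_one.mpr hχ
  have hsum : ∑ ψ : MulChar F ℂ, ((Fintype.card F : ℝ) ^ 3 -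
      ((Fintype.card F : ℝ) ^ 3 - (Fintype.card F : ℝ) ^ 2) *
      ((if ψ = 1 then 1 else 0) + (if ψ = χ then 1 else 0) + (if ψ = χ⁻¹ then 1 else 0))) =
      (Fintype.card F : ℝ) ^ 2 * ((Fintype.card F : ℝ) - 1) * ((Fintype.card F : ℝ) - 3) := by
    simp_rw [Finset.sum_sub_distrib, ← Finset.mul_sum, Finset.sum_add_distrib]
    simp only [Finset.sum_const, Finset.card_univ, nsmul_eq_mul, Finset.sum_ite_eq',
      Finset.mem_univ, if_true, hd_card_mulchar]
    ring
  have main := hd_cauchy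
    (fun ψ : MulChar F ℂ => gaussSum ψ θ * gaussSum (ψ * χ) θ * gaussSum (ψ * χ⁻¹) θ)
    (fun ψ : MulChar F ℂ => (Fintype.card F : ℂ) * ∑ u, ψ u ^ 3 * θ (3 * u))
    ((Fintype.card F : ℝ) ^ 2 * ((Fintype.card F : ℝ) - 1) * ((Fintype.card F : ℝ) - 3)) ?_ ?_ ?_ ψ
  · rw [main, ← hd_scale_sq ψ 3 3 h3 three_ne_zero]
    ring
  · rw [← hsum]
    refine Finset.sum_le_sum fun ψ _ => le_of_eq ?_
    rw [hd_norm_mul, hd_norm_mul, hd_g_norm hθ, hd_g_norm hθ, hd_g_norm hθ]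
    have e : ψ * χ = 1 ↔ ψ = χ⁻¹ := mul_eq_one_iff_eq_inv
    have e' : ψ * χ⁻¹ = 1 ↔ ψ = χ := mul_inv_eq_one
    rw [if_congr e rfl rfl, if_congr e' rfl rfl]
    by_cases h1 : ψ = 1
    · subst h1; simp only [hχ.symm, hi1.symm, if_true, if_false]; ring
    · by_cases h4 : ψ = χ
      · simp only [h4, hχ, hne.symm, if_true, if_false]; ring
      · by_cases h5 : ψ = χ⁻¹
        · simp only [h5, hi1, hne, if_true, if_false]; ring
        · simp only [h1, h4, h5, if_false]; ring
  · rw [← hsum]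
    refine Finset.sum_le_sum fun ψ _ => ?_
    rw [hd_norm_mul, hd_norm_scaled ψ 3 3 h3 three_ne_zero, hd_g_norm hθ]
    simp only [Complex.norm_natCast]
    by_cases h1 : ψ = 1
    · subst h1; simp [hχ.symm, hi1.symm]
    · by_cases h4 : ψ = χ
      · simp [h4, hχ, hne.symm, hχ3]
      · by_cases h5 : ψ = χ⁻¹
        · simp [h5, hχ, hne, hχ3]
        · simp only [h1, h4, h5, if_false]
          split_ifs <;> nlinarith [sq_nonneg (Fintype.card F : ℝ)]
  · have := hd_trip_sum hθ hχ hχ3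
    rw [this]
    have e : (Fintype.card F : ℂ) * ((Fintype.card F : ℂ) - 1) * ((Fintype.card F : ℂ) * (hdT F).card) =
      (((Fintype.card F : ℝ) * ((Fintype.card F : ℝ) - 1) * ((Fintype.card F : ℝ) * (hdT F).card) : ℝ) : ℂ) := by
      push_cast; ring
    rw [e, Complex.ofReal_re]
    have hc : (Fintype.card F : ℝ) ≤ (hdT F).card + 3 := by exact_mod_cast hdT_card (F := F)
    have h7 : 0 ≤ (Fintype.card F : ℝ) ^ 2 * ((Fintype.card F : ℝ) - 1) := by
      apply mul_nonneg (sq_nonneg _); linarith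
    nlinarith

end HDtrip

section HDsix
set_option linter.unusedSectionVars false
variable {F : Type} [Field F] [Fintype F] {θ : AddChar F ℂ}

lemma hd_char_one (c : F) (hc : c ≠ 0) : (1 : MulChar F ℂ) c = 1 :=
  MulChar.one_apply (isUnit_iff_ne_zero.mpr hc)

lemma hd_six (hθ : θ.IsPrimitive) {σ : MulChar F ℂ} (h6 : σ ^ 6 = 1) (hs2 : σ ^ 2 ≠ 1)
    (hs3 : σ ^ 3 ≠ 1) (h2 : (2 : F) ≠ 0) (h3 : (3 : F) ≠ 0) (ψ : MulChar F ℂ) :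
    ψ 6 ^ 6 * (gaussSum ψ θ * (gaussSum (ψ * σ) θ * gaussSum (ψ * σ ^ 2) θ *
      gaussSum (ψ * σ ^ 3) θ * gaussSum (ψ * σ ^ 4) θ * gaussSum (ψ * σ ^ 5) θ)) =
      gaussSum (σ ^ 3) θ ^ 3 * Fintype.card F * gaussSum (ψ ^ 6) θ := by
  have hφ2 : (σ ^ 3) ^ 2 = 1 := by rw [← pow_mul]; exact h6
  have hχ3 : (σ ^ 2) ^ 3 = 1 := by rw [← pow_mul]; exact h6
  have hχi : (σ ^ 2)⁻¹ = σ ^ 4 := by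
    rw [inv_eq_iff_mul_eq_one, ← pow_add]; exact h6
  have d0 := hd_dup hθ hs3 hφ2 h2 ψ
  have d1 := hd_dup hθ hs3 hφ2 h2 (ψ * σ ^ 2)
  have d2 := hd_dup hθ hs3 hφ2 h2 (ψ * σ ^ 4)
  have t := hd_trip hθ hs2 hχ3 h3 (ψ ^ 2)
  have e1 : ψ * σ ^ 2 * σ ^ 3 = ψ * σ ^ 5 := by rw [mul_assoc, ← pow_add]
  have e2 : ψ * σ ^ 4 * σ ^ 3 = ψ * σ := by
    rw [mul_assoc, ← pow_add, show 4 + 3 = 6 + 1 from rfl, pow_add, h6]; simp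
  have e3 : (ψ * σ ^ 2) ^ 2 = ψ ^ 2 * σ ^ 4 := by rw [mul_pow, ← pow_mul]
  have e4 : (ψ * σ ^ 4) ^ 2 = ψ ^ 2 * σ ^ 2 := by
    rw [mul_pow, ← pow_mul, show 4 * 2 = 6 + 2 from rfl, pow_add, h6]; simp
  have e5 : (ψ ^ 2) ^ 3 = ψ ^ 6 := by rw [← pow_mul]
  rw [e1, e3, MulChar.mul_apply] at d1
  rw [e2, e4, MulChar.mul_apply] at d2
  rw [hχi, e5, MulChar.pow_apply' ψ two_ne_zero] at t
  have hc : (σ ^ 2) 2 * (σ ^ 4) 2 = 1 := by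
    rw [← MulChar.mul_apply, ← pow_add, show 2 + 4 = 6 from rfl, h6, hd_char_one _ h2]
  have hψ6 : ψ 6 = ψ 2 * ψ 3 := by rw [← map_mul]; norm_num
  rw [hψ6]
  set A := gaussSum (σ ^ 3) θ
  set a0 := gaussSum ψ θ
  set a1 := gaussSum (ψ * σ) θ
  set a2 := gaussSum (ψ * σ ^ 2) θ
  set a3 := gaussSum (ψ * σ ^ 3) θ
  set a4 := gaussSum (ψ * σ ^ 4) θ
  set a5 := gaussSum (ψ * σ ^ 5) θ
  set b0 := gaussSum (ψ ^ 2) θ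
  set b2 := gaussSum (ψ ^ 2 * σ ^ 2) θ
  set b4 := gaussSum (ψ ^ 2 * σ ^ 4) θ
  have prod : ψ 2 ^ 2 * (a0 * a3) * ((ψ 2 * (σ ^ 2) 2) ^ 2 * (a2 * a5)) *
      ((ψ 2 * (σ ^ 4) 2) ^ 2 * (a4 * a1)) = A * b0 * (A * b4) * (A * b2) := by
    rw [d0, d1, d2]
  have prod' : ψ 2 ^ 6 * (a0 * a1 * a2 * a3 * a4 * a5) = A ^ 3 * (b0 * b2 * b4) := by
    have : (ψ 2 ^ 6 * (a0 * a1 * a2 * a3 * a4 * a5)) * ((σ ^ 2) 2 * (σ ^ 4) 2) ^ 2 =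
      A ^ 3 * (b0 * b2 * b4) := by linear_combination prod
    rwa [hc, one_pow, mul_one] at this
  linear_combination ψ 3 ^ 6 * prod' + A ^ 3 * t

lemma hd_six_P (hθ : θ.IsPrimitive) {σ : MulChar F ℂ} (h6 : σ ^ 6 = 1) (hs2 : σ ^ 2 ≠ 1)
    (hs3 : σ ^ 3 ≠ 1) (h2 : (2 : F) ≠ 0) (h3 : (3 : F) ≠ 0) :
    gaussSum σ θ * gaussSum (σ ^ 2) θ *
      gaussSum (σ ^ 3) θ * gaussSum (σ ^ 4) θ * gaussSum (σ ^ 5) θ =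
      gaussSum (σ ^ 3) θ ^ 3 * Fintype.card F := by
  have h := hd_six hθ h6 hs2 hs3 h2 h3 1
  have h66 : (6 : F) ≠ 0 := by
    have : (6 : F) = 2 * 3 := by norm_num
    rw [this]; exact mul_ne_zero h2 h3
  simp only [one_mul, one_pow, hd_char_one _ h66, hd_g_one hθ] at h
  linear_combination -h

lemma hd_neg_sq (χ : MulChar F ℂ) : χ (-1) * χ (-1) = 1 := by
  rw [← map_mul]; simp

lemma hd_six_Psq (hθ : θ.IsPrimitive) {σ : MulChar F ℂ} (h6 : σ ^ 6 = 1)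
    (hs3 : σ ^ 3 ≠ 1) :
    (gaussSum (σ ^ 3) θ ^ 3 * Fintype.card F) ^ 2 = σ (-1) * (Fintype.card F : ℂ) ^ 5 := by
  have h := hd_g_inv hθ hs3
  have hi : (σ ^ 3)⁻¹ = σ ^ 3 := by rw [inv_eq_iff_mul_eq_one, ← pow_add]; exact h6
  rw [hi, MulChar.pow_apply' σ three_ne_zero] at h
  have hn := hd_neg_sq σ
  have h' : gaussSum (σ ^ 3) θ ^ 2 = σ (-1) * Fintype.card F := by
    linear_combination h + σ (-1) * Fintype.card F * hn
  calc (gaussSum (σ ^ 3) θ ^ 3 * Fintype.card F) ^ 2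
      = (gaussSum (σ ^ 3) θ ^ 2) ^ 3 * (Fintype.card F : ℂ) ^ 2 := by ring
    _ = _ := by rw [h']; linear_combination (σ (-1) * (Fintype.card F : ℂ) ^ 5) * hn

lemma hd_jacobi (A B : MulChar F ℂ) : jacobiS F ![A, B] = jacobiSum A B := by
  unfold jacobiS jacobiSum
  refine Finset.sum_bij' (fun v _ => v 0) (fun x _ => ![x, 1 - x]) ?_ ?_ ?_ ?_ ?_
  · simp
  · simp
  · intro v hv
    simp only [Finset.mem_filter, Finset.mem_univ, true_and, Fin.sum_univ_two] at hv
    ext i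
    fin_cases i
    · simp
    · simp [← hv]
  · simp
  · intro v hv
    simp only [Finset.mem_filter, Finset.mem_univ, true_and, Fin.sum_univ_two] at hv
    simp [Fin.prod_univ_two, ← hv]

lemma hd_binom (hθ : θ.IsPrimitive) {A ψ : MulChar F ℂ} (hA : A ≠ 1) :
    gBinom F (A * ψ⁻¹) ψ⁻¹ = A (-1) * (if ψ = A then 1 / (Fintype.card F : ℂ) else 1) *
      gaussSum ψ θ / (gaussSum A θ * gaussSum (ψ * A⁻¹) θ) := by
  have hq : (Fintype.card F : ℂ) ≠ 0 := by exact_mod_cast Fintype.card_ne_zero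
  unfold gBinom
  rw [hd_jacobi, inv_inv]
  have hAA : A * ψ⁻¹ * ψ = A := by simp
  have hJ := jacobiSum_mul_nontrivial (χ := A * ψ⁻¹) (φ := ψ) (by rw [hAA]; exact hA) θ
  rw [hAA] at hJ
  have n1 := hd_g_ne hθ A
  have n2 := hd_g_ne hθ (ψ * A⁻¹)
  have hinv : (ψ⁻¹ : MulChar F ℂ) (-1) = ψ (-1) := by
    rw [MulChar.inv_apply']; congr 1; norm_num
  have hinvA : (A⁻¹ : MulChar F ℂ) (-1) = A (-1) := by
    rw [MulChar.inv_apply']; congr 1; norm_num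
  have hψ := hd_neg_sq ψ
  rw [hinv, eq_div_iff (mul_ne_zero n1 n2)]
  by_cases h : ψ = A
  · rw [if_pos h]
    subst h
    rw [mul_inv_cancel, hd_g_one hθ, jacobiSum_one_nontrivial hA]
    field_simp
    try ring
  · rw [if_neg h]
    have hne : ψ * A⁻¹ ≠ 1 := by rw [Ne, mul_inv_eq_one]; exact h
    have hg := hd_g_inv hθ hne
    rw [mul_inv, inv_inv, mul_comm ψ⁻¹ A, MulChar.mul_apply, hinvA] at hg
    field_simp
    linear_combination (ψ (-1) * gaussSum (ψ * A⁻¹) θ) * hJ + ψ (-1) * gaussSum ψ θ * hg +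
      A (-1) * Fintype.card F * gaussSum ψ θ * hψ

lemma hd_term (hθ : θ.IsPrimitive) {σ : MulChar F ℂ} (ho : orderOf σ = 6)
    (h2 : (2 : F) ≠ 0) (h3 : (3 : F) ≠ 0) {lam : F} (hlam : lam ≠ 0) (ψ : MulChar F ℂ) :
    gaussSum ψ θ ^ 6 / gaussSum (ψ ^ 6) θ * (ψ ^ 6) (6 * lam) +
      (∑ k ∈ Finset.Icc 1 5, if ψ = σ ^ k then 1 else 0) *
        (((Fintype.card F : ℂ) - 1) / Fintype.card F * gaussSum ψ θ ^ 6) =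
    (Fintype.card F : ℂ) ^ 5 * (gBinom F (σ * ψ⁻¹) ψ⁻¹ * (gBinom F (σ ^ 2 * ψ⁻¹) ψ⁻¹ *
      gBinom F (σ ^ 3 * ψ⁻¹) ψ⁻¹ * gBinom F (σ ^ 4 * ψ⁻¹) ψ⁻¹ * gBinom F (σ ^ 5 * ψ⁻¹) ψ⁻¹) *
      ψ⁻¹ (lam ^ 6)⁻¹) := by
  have hq : (Fintype.card F : ℂ) ≠ 0 := by exact_mod_cast Fintype.card_ne_zero
  have h66 : (6 : F) ≠ 0 := by
    have : (6 : F) = 2 * 3 := by norm_num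
    rw [this]; exact mul_ne_zero h2 h3
  have h6 : σ ^ 6 = 1 := by rw [← ho]; exact pow_orderOf_eq_one σ
  have hn : ∀ k, k ≠ 0 → k < 6 → σ ^ k ≠ 1 := fun k hk hk6 =>
    pow_ne_one_of_lt_orderOf hk (by rw [ho]; exact hk6)
  have hs1 : σ ≠ 1 := by simpa using hn 1 (by norm_num) (by norm_num)
  have hs2 := hn 2 (by norm_num) (by norm_num)
  have hs3 := hn 3 (by norm_num) (by norm_num)
  have hs4 := hn 4 (by norm_num) (by norm_num)
  have hs5 := hn 5 (by norm_num) (by norm_num)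
  have i1 : σ⁻¹ = σ ^ 5 := by rw [inv_eq_iff_mul_eq_one, ← pow_succ']; exact h6
  have i2 : (σ ^ 2)⁻¹ = σ ^ 4 := by rw [inv_eq_iff_mul_eq_one, ← pow_add]; exact h6
  have i3 : (σ ^ 3)⁻¹ = σ ^ 3 := by rw [inv_eq_iff_mul_eq_one, ← pow_add]; exact h6
  have i4 : (σ ^ 4)⁻¹ = σ ^ 2 := by rw [inv_eq_iff_mul_eq_one, ← pow_add]; exact h6
  have i5 : (σ ^ 5)⁻¹ = σ := by rw [inv_eq_iff_mul_eq_one, ← pow_succ]; exact h6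
  rw [hd_binom hθ hs1, hd_binom hθ hs2, hd_binom hθ hs3, hd_binom hθ hs4, hd_binom hθ hs5,
    i1, i2, i3, i4, i5]
  have hL : (ψ⁻¹ : MulChar F ℂ) (lam ^ 6)⁻¹ = ψ lam ^ 6 := by
    rw [MulChar.inv_apply', inv_inv, map_pow]
  have hc : ∏ k ∈ Finset.Icc 1 5, (if ψ = σ ^ k then 1 / (Fintype.card F : ℂ) else 1) =
      (if ψ = σ then 1 / (Fintype.card F : ℂ) else 1) *
      (if ψ = σ ^ 2 then 1 / (Fintype.card F : ℂ) else 1) *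
      (if ψ = σ ^ 3 then 1 / (Fintype.card F : ℂ) else 1) *
      (if ψ = σ ^ 4 then 1 / (Fintype.card F : ℂ) else 1) *
      (if ψ = σ ^ 5 then 1 / (Fintype.card F : ℂ) else 1) := by
    rw [show Finset.Icc 1 5 = {1, 2, 3, 4, 5} from rfl]
    simp [Finset.prod_insert, mul_assoc]
  have hsix := hd_six hθ h6 hs2 hs3 h2 h3 ψ
  have hP := hd_six_P hθ h6 hs2 hs3 h2 h3
  have hP2 := hd_six_Psq hθ h6 hs3
  rw [← hP] at hP2 hsix
  have hR : (ψ ^ 6) (6 * lam) = ψ 6 ^ 6 * ψ lam ^ 6 := by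
    rw [MulChar.pow_apply' ψ (by norm_num), map_mul, mul_pow]
  have hsn := hd_neg_sq σ
  have key : (∏ k ∈ Finset.Icc 1 5, (if ψ = σ ^ k then 1 / (Fintype.card F : ℂ) else 1)) *
      (gaussSum ψ θ ^ 6 / gaussSum (ψ ^ 6) θ * (ψ ^ 6) (6 * lam)) =
      (Fintype.card F : ℂ) ^ 5 *
    (σ (-1) * (if ψ = σ then 1 / (Fintype.card F : ℂ) else 1) * gaussSum ψ θ /
       (gaussSum σ θ * gaussSum (ψ * σ ^ 5) θ) *
      ((σ ^ 2) (-1) * (if ψ = σ ^ 2 then 1 / (Fintype.card F : ℂ) else 1) * gaussSum ψ θ /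
       (gaussSum (σ ^ 2) θ * gaussSum (ψ * σ ^ 4) θ) *
      ((σ ^ 3) (-1) * (if ψ = σ ^ 3 then 1 / (Fintype.card F : ℂ) else 1) * gaussSum ψ θ /
       (gaussSum (σ ^ 3) θ * gaussSum (ψ * σ ^ 3) θ)) *
      ((σ ^ 4) (-1) * (if ψ = σ ^ 4 then 1 / (Fintype.card F : ℂ) else 1) * gaussSum ψ θ /
       (gaussSum (σ ^ 4) θ * gaussSum (ψ * σ ^ 2) θ)) *
      ((σ ^ 5) (-1) * (if ψ = σ ^ 5 then 1 / (Fintype.card F : ℂ) else 1) * gaussSum ψ θ /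
       (gaussSum (σ ^ 5) θ * gaussSum (ψ * σ) θ))) * ψ lam ^ 6) := by
    rw [hc, hR]
    generalize (if ψ = σ then 1 / (Fintype.card F : ℂ) else 1) = c1
    generalize (if ψ = σ ^ 2 then 1 / (Fintype.card F : ℂ) else 1) = c2
    generalize (if ψ = σ ^ 3 then 1 / (Fintype.card F : ℂ) else 1) = c3
    generalize (if ψ = σ ^ 4 then 1 / (Fintype.card F : ℂ) else 1) = c4
    generalize (if ψ = σ ^ 5 then 1 / (Fintype.card F : ℂ) else 1) = c5
    have hp : ∀ n : ℕ, n ≠ 0 → (σ ^ n) (-1) = σ (-1) ^ n := fun n hn => MulChar.pow_apply' σ hn _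
    rw [hp 2 (by norm_num), hp 3 (by norm_num), hp 4 (by norm_num), hp 5 (by norm_num)]
    have g0 := hd_g_ne hθ ψ
    have gg := hd_g_ne hθ (ψ ^ 6)
    have a1 := hd_g_ne hθ (ψ * σ)
    have a2 := hd_g_ne hθ (ψ * σ ^ 2)
    have a3 := hd_g_ne hθ (ψ * σ ^ 3)
    have a4 := hd_g_ne hθ (ψ * σ ^ 4)
    have a5 := hd_g_ne hθ (ψ * σ ^ 5)
    have b1 := hd_g_ne hθ σ
    have b2 := hd_g_ne hθ (σ ^ 2)
    have b3 := hd_g_ne hθ (σ ^ 3)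
    have b4 := hd_g_ne hθ (σ ^ 4)
    have b5 := hd_g_ne hθ (σ ^ 5)
    generalize gaussSum ψ θ = G0 at *
    generalize gaussSum (ψ ^ 6) θ = GG at *
    generalize gaussSum (ψ * σ) θ = A1 at *
    generalize gaussSum (ψ * σ ^ 2) θ = A2 at *
    generalize gaussSum (ψ * σ ^ 3) θ = A3 at *
    generalize gaussSum (ψ * σ ^ 4) θ = A4 at *
    generalize gaussSum (ψ * σ ^ 5) θ = A5 at *
    generalize gaussSum σ θ = B1 at *
    generalize gaussSum (σ ^ 2) θ = B2 at *
    generalize gaussSum (σ ^ 3) θ = B3 at *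
    generalize gaussSum (σ ^ 4) θ = B4 at *
    generalize gaussSum (σ ^ 5) θ = B5 at *
    generalize σ (-1) = s at *
    generalize ψ 6 = x at *
    generalize ψ lam = l at *
    generalize (Fintype.card F : ℂ) = Q at *
    have hs15 : s ^ 15 = s := by
      calc s ^ 15 = (s * s) ^ 7 * s := by ring
        _ = s := by rw [hsn]; ring
    have L : c1 * c2 * c3 * c4 * c5 * (G0 ^ 6 / GG * (x ^ 6 * l ^ 6)) =
        c1 * c2 * c3 * c4 * c5 * l ^ 6 * G0 ^ 5 * (B1 * B2 * B3 * B4 * B5) /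
          (A1 * A2 * A3 * A4 * A5) := by
      rw [eq_div_iff (by simp [a1, a2, a3, a4, a5])]
      field_simp
      linear_combination (c1 * c2 * c3 * c4 * c5 * l ^ 6) * hsix
    rw [L]
    have R : Q ^ 5 * (s * c1 * G0 / (B1 * A5) * (s ^ 2 * c2 * G0 / (B2 * A4) *
        (s ^ 3 * c3 * G0 / (B3 * A3)) * (s ^ 4 * c4 * G0 / (B4 * A2)) *
        (s ^ 5 * c5 * G0 / (B5 * A1))) * l ^ 6) =
        c1 * c2 * c3 * c4 * c5 * l ^ 6 * G0 ^ 5 * (s ^ 15 * Q ^ 5) /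
          ((B1 * B2 * B3 * B4 * B5) * (A1 * A2 * A3 * A4 * A5)) := by
      field_simp
    rw [R, hs15, ← hP2]
    field_simp
  rw [hL, ← key]
  by_cases hex : ∃ k ∈ Finset.Icc 1 5, ψ = σ ^ k
  · obtain ⟨k, hk, hψk⟩ := hex
    have huniq : ∀ b ∈ Finset.Icc 1 5, b ≠ k → ¬ (ψ = σ ^ b) := by
      intro b hb hbk h
      rw [Finset.mem_Icc] at hb hk
      apply hbk
      refine pow_injOn_Iio_orderOf (x := σ) ?_ ?_ (h.symm.trans hψk)
      · rw [Set.mem_Iio, ho]; omega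
      · rw [Set.mem_Iio, ho]; omega
    rw [Finset.sum_eq_single k (fun b hb hbk => if_neg (huniq b hb hbk)) (fun h => absurd hk h),
      Finset.prod_eq_single k (fun b hb hbk => if_neg (huniq b hb hbk)) (fun h => absurd hk h),
      if_pos hψk, if_pos hψk]
    have hψ6 : ψ ^ 6 = 1 := by rw [hψk, ← pow_mul, mul_comm, pow_mul, h6, one_pow]
    rw [hψ6, hd_g_one hθ, hd_char_one _ (mul_ne_zero h66 hlam)]
    field_simp
    ring
  · push Not at hex
    rw [Finset.sum_eq_zero (fun b hb => if_neg (hex b hb)),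
      Finset.prod_eq_one (fun b hb => if_neg (hex b hb))]
    ring

end HDsix

section HDfinal
variable {F : Type} [Field F] [Fintype F]

lemma hd_theta (p : ℕ) [Fact p.Prime] [Algebra (ZMod p) F] :
    ∃ θ : AddChar F ℂ, θ.IsPrimitive ∧ ∀ χ : MulChar F ℂ, gaussChar p F χ = gaussSum χ θ := by
  refine ⟨(ZMod.stdAddChar (N := p)).compAddMonoidHom
    (Algebra.trace (ZMod p) F).toAddMonoidHom, ?_, ?_⟩
  · apply AddChar.IsPrimitive.of_ne_one
    intro h
    obtain ⟨x, hx⟩ := Algebra.trace_surjective (ZMod p) F 1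
    have h1 := DFunLike.congr_fun h x
    simp only [AddChar.compAddMonoidHom_apply, LinearMap.toAddMonoidHom_coe, hx,
      AddChar.one_apply] at h1
    have := ZMod.injective_stdAddChar (h1.trans (AddChar.map_zero_eq_one _).symm)
    exact one_ne_zero this
  · intro χ
    unfold gaussChar gaussSum
    refine Finset.sum_congr rfl fun x _ => ?_
    congr 1
    simp only [AddChar.compAddMonoidHom_apply, LinearMap.toAddMonoidHom_coe]
    have := ZMod.stdAddChar_coe (N := p) ((Algebra.trace (ZMod p) F x).val : ℤ)
    rw [Int.cast_natCast, ZMod.natCast_zmod_val] at this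
    rw [this]
    push_cast
    rfl

lemma hd_order {ω : MulChar F ℂ} (hω : ∀ χ : MulChar F ℂ, ∃ j : ℕ, χ = ω ^ j) :
    orderOf ω = Fintype.card F - 1 := by
  have h : ∀ x, x ∈ Subgroup.zpowers ω := by
    intro x
    obtain ⟨j, hj⟩ := hω x
    exact ⟨j, by simp [hj]⟩
  rw [orderOf_eq_card_of_forall_mem_zpowers h,
    MulChar.card_eq_card_units_of_hasEnoughRootsOfUnity,
      Nat.card_eq_fintype_card, Fintype.card_eq_card_units_add_one (α := F)]
  simp

lemma hd_sum_range [Fintype (MulChar F ℂ)] {ω : MulChar F ℂ}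
    (hω : ∀ χ : MulChar F ℂ, ∃ j : ℕ, χ = ω ^ j) (f : MulChar F ℂ → ℂ) :
    ∑ j ∈ Finset.range (Fintype.card F - 1), f (ω ^ j) = ∑ ψ, f ψ := by
  have ho := hd_order hω
  refine Finset.sum_nbij (fun j => ω ^ j) (by simp) ?_ ?_ (fun _ _ => rfl)
  · intro a ha b hb hab
    refine pow_injOn_Iio_orderOf (x := ω) ?_ ?_ hab
    · simpa [ho] using ha
    · simpa [ho] using hb
  · intro ψ _
    obtain ⟨j, hj⟩ := hω ψ
    have hpos : 0 < orderOf ω := by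
      rw [ho]; have := Fintype.one_lt_card (α := F); omega
    refine ⟨j % orderOf ω, ?_, ?_⟩
    · have := Nat.mod_lt j hpos
      simpa [← ho] using this
    · simp [hj]

lemma hd_Nq (p : ℕ) [Algebra (ZMod p) F] (ω : MulChar F ℂ) {θ : AddChar F ℂ}
    (hg : ∀ χ : MulChar F ℂ, gaussChar p F χ = gaussSum χ θ) :
    (∑ k ∈ Finset.range 6,
      NqW p F ω 6 (fun i => (![0,0,0,0,0,0] : Fin 6 → ZMod 6) i + (k : ZMod 6))) =
    ((Fintype.card F : ℂ) ^ 5 - 1) / ((Fintype.card F : ℂ) - 1) +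
      ∑ k ∈ Finset.Icc 1 5, 1 / (Fintype.card F : ℂ) *
        gaussSum ((ω ^ ((Fintype.card F - 1) / 6)) ^ k) θ ^ 6 := by
  have hz : ∀ i : Fin 6, (![0,0,0,0,0,0] : Fin 6 → ZMod 6) i = 0 := by decide
  simp only [hz, zero_add]
  rw [Finset.sum_range_succ']
  refine (add_comm _ _).trans ?_
  refine congrArg₂ (· + ·) ?_ ?_
  · unfold NqW
    simp
  · rw [Finset.range_eq_Ico, Finset.sum_Ico_add' (fun k : ℕ => NqW p F ω 6
      (fun _ : Fin 6 => (k : ZMod 6))) 0 5 1]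
    refine Finset.sum_congr rfl fun k hk => ?_
    have hk' : 1 ≤ k ∧ k ≤ 5 := by
      rw [Finset.mem_Icc] at hk; omega
    have hne : (k : ZMod 6) ≠ 0 := by
      obtain ⟨h1, h2⟩ := hk'
      interval_cases k <;> decide
    have hval : (k : ZMod 6).val = k := ZMod.val_natCast_of_lt (by omega)
    unfold NqW
    rw [if_neg (fun h => hne (h 0)), if_pos (fun _ => hne)]
    simp only [hg, hval, Finset.prod_const, Finset.card_univ, Fintype.card_fin]
    rw [mul_comm k, pow_mul]

end HDfinal

/-- The contribution of the class of `w = (0,0,0,0,0,0)` in Koblitz's formula. -/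
theorem class_000000 (p e q t : ℕ) [Fact p.Prime] (F : Type) [Field F] [Fintype F]
    [Algebra (ZMod p) F]
    (he : 0 < e) (hq : q = Fintype.card F) (hqe : q = p ^ e) (hmod : q % 6 = 1)
    (ht : t = (q - 1) / 6)
    (ω : MulChar F ℂ) (hω : ∀ χ : MulChar F ℂ, ∃ j : ℕ, χ = ω ^ j)
    (ω₆ ω₃ ω₂ : MulChar F ℂ)
    (hω₆ : ω₆ = ω ^ t) (hω₃ : ω₃ = ω ^ (2 * t)) (hω₂ : ω₂ = ω ^ (3 * t))
    (lam : F) (hlam : lam ≠ 0) (hlam6 : lam ^ 6 ≠ 1) :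
    (∑ k ∈ Finset.range 6, NqW p F ω 6 (fun i => (![0,0,0,0,0,0] : Fin 6 → ZMod 6) i + (k : ZMod 6))) +
      SW p F ω 6 (fun _ => 1) (![0,0,0,0,0,0] : Fin 6 → ZMod 6) lam =
      ((q : ℂ) ^ 5 - 1) / ((q : ℂ) - 1) +
      (q : ℂ) ^ 4 * greeneF F ω ![ω₆, ω₃, ω₂, ω₃⁻¹, ω₆⁻¹] ![1, 1, 1, 1] (lam ^ 6)⁻¹ := by
  obtain ⟨θ, hθ, hg⟩ := hd_theta (F := F) p
  let _ : Fintype (MulChar F ℂ) := Fintype.ofFinite _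
  have hcard := Fintype.one_lt_card (α := F)
  have hqt : q - 1 = 6 * t := by omega
  have ht0 : t ≠ 0 := by omega
  have hq1 : q = 6 * t + 1 := by omega
  have hzero : ((6 * t + 1 : ℕ) : F) = 0 := by
    rw [← hq1, hq]; exact Nat.cast_card_eq_zero F
  push_cast at hzero
  have h2 : (2 : F) ≠ 0 := by
    intro h
    have : (1 : F) = 0 := by linear_combination hzero - 3 * t * h
    exact one_ne_zero this
  have h3 : (3 : F) ≠ 0 := by
    intro h
    have : (1 : F) = 0 := by linear_combination hzero - 2 * t * h
    exact one_ne_zero this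
  have hoω : orderOf ω = 6 * t := by rw [hd_order hω, ← hq, hqt]
  set σ := ω ^ t with hσ
  have ho : orderOf σ = 6 := by
    rw [hσ, orderOf_pow_of_dvd ht0 (by rw [hoω]; exact Dvd.intro_left 6 rfl), hoω]
    exact Nat.mul_div_cancel 6 (by omega)
  have h6 : σ ^ 6 = 1 := by rw [← ho]; exact pow_orderOf_eq_one σ
  have e3 : ω₃ = σ ^ 2 := by rw [hω₃, hσ, ← pow_mul, mul_comm]
  have e2 : ω₂ = σ ^ 3 := by rw [hω₂, hσ, ← pow_mul, mul_comm]
  have i1 : σ⁻¹ = σ ^ 5 := by rw [inv_eq_iff_mul_eq_one, ← pow_succ']; exact h6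
  have i2 : (σ ^ 2)⁻¹ = σ ^ 4 := by rw [inv_eq_iff_mul_eq_one, ← pow_add]; exact h6
  have hqC : (Fintype.card F : ℂ) ≠ 0 := by exact_mod_cast Fintype.card_ne_zero
  have hqC1 : (Fintype.card F : ℂ) - 1 ≠ 0 := by
    rw [sub_ne_zero]; exact_mod_cast hcard.ne'
  rw [hd_Nq p ω hg, ← hq, ← ht, ← hσ, add_assoc, hω₆, e3, e2, i1, i2, hq]
  congr 1
  have hS : SW p F ω 6 (fun _ => 1) (![0,0,0,0,0,0] : Fin 6 → ZMod 6) lam =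
      ((Fintype.card F : ℂ) - 1)⁻¹ *
      ∑ ψ : MulChar F ℂ, gaussSum ψ θ ^ 6 / gaussSum (ψ ^ 6) θ * (ψ ^ 6) (6 * lam) := by
    rw [← hd_sum_range hω]
    unfold SW
    congr 1
    refine Finset.sum_congr rfl fun j _ => ?_
    have hz : ∀ i : Fin 6, (![0,0,0,0,0,0] : Fin 6 → ZMod 6) i = 0 := by decide
    simp only [hg, hz, ZMod.val_zero, zero_mul, zero_add, one_mul, Finset.prod_const,
      Finset.card_univ, Fintype.card_fin, mul_comm 6 j, pow_mul]
    norm_num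
  have hG : greeneF F ω ![σ, σ ^ 2, σ ^ 3, σ ^ 4, σ ^ 5] ![1, 1, 1, 1] (lam ^ 6)⁻¹ =
      (Fintype.card F : ℂ) / ((Fintype.card F : ℂ) - 1) *
      ∑ ψ : MulChar F ℂ, (gBinom F (σ * ψ⁻¹) ψ⁻¹ * (gBinom F (σ ^ 2 * ψ⁻¹) ψ⁻¹ *
      gBinom F (σ ^ 3 * ψ⁻¹) ψ⁻¹ * gBinom F (σ ^ 4 * ψ⁻¹) ψ⁻¹ * gBinom F (σ ^ 5 * ψ⁻¹) ψ⁻¹) *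
      ψ⁻¹ (lam ^ 6)⁻¹) := by
    have hE := Equiv.sum_comp (Equiv.inv (MulChar F ℂ)) (fun ψ : MulChar F ℂ =>
      gBinom F (σ * ψ) ψ * (gBinom F (σ ^ 2 * ψ) ψ *
      gBinom F (σ ^ 3 * ψ) ψ * gBinom F (σ ^ 4 * ψ) ψ * gBinom F (σ ^ 5 * ψ) ψ) *
      ψ (lam ^ 6)⁻¹)
    simp only [Equiv.inv_apply] at hE
    rw [hE, ← hd_sum_range hω]
    unfold greeneF
    congr 1
    refine Finset.sum_congr rfl fun j _ => ?_
    rw [Fin.prod_univ_four]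
    simp
  have hK : ∑ ψ : MulChar F ℂ, (∑ k ∈ Finset.Icc 1 5, if ψ = σ ^ k then (1 : ℂ) else 0) *
        (((Fintype.card F : ℂ) - 1) / Fintype.card F * gaussSum ψ θ ^ 6) =
      ∑ k ∈ Finset.Icc 1 5,
        ((Fintype.card F : ℂ) - 1) / Fintype.card F * gaussSum (σ ^ k) θ ^ 6 := by
    simp only [Finset.sum_mul]
    rw [Finset.sum_comm]
    refine Finset.sum_congr rfl fun k _ => ?_
    simp
  have hT := Finset.sum_congr rfl fun ψ (_ : ψ ∈ (Finset.univ : Finset (MulChar F ℂ))) =>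
    hd_term hθ ho h2 h3 hlam ψ
  rw [Finset.sum_add_distrib, hK, ← Finset.mul_sum, ← Finset.mul_sum] at hT
  rw [hS, hG, ← Finset.mul_sum]
  field_simp at hT ⊢
  linear_combination hT
end
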